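/- arXiv:q-alg/9505025 — 5 statements merged into one kernel-verified Lean document; each statement's English description precedes it below -/
import Mathlib

section
/- In the algebra U_h(ĝl₂)_k, every Fourier coefficient of each of the two power series k₁⁺(z)·k₂⁺(zq^{−2}) − 1 and k₁⁻(z)·k₂⁻(zq^{−2}) − 1 (each coefficient being a finite sum of products of generators) is a central element of U_h(ĝl₂)_k. -/
/-!
The quantum affine algebra `U_h(ĝl₂)_k` in the Drinfeld-type realization, presented by
generators and coefficientwise relations, and the centrality of the Fourier coefficients of
the series `k₁^±(z)·k₂^±(zq^{−2}) − 1`.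

Conventions: `q = e^h` (with `Re h < 0`, so `0 < |q| < 1`), `q^c = exp(h·c)`.  The index
`i : Fin 2` with `i = 0` stands for the subscript `1` and `i = 1` for the subscript `2`.
The series are `E(z) = Σ_{n∈ℤ} E[n]z^{−n}`, `F(z) = Σ_{n∈ℤ} F[n]z^{−n}`,
`k_i^+(z) = Σ_{n≥0} k_i^+[−n]zⁿ`, `k_i^−(z) = Σ_{n≥0} k_i^−[n]z^{−n}`, and every relation
below is the equality of the coefficient of a fixed monomial in `z, w` of the corresponding
relation between formal series.
-/

noncomputable section

open Finset

/-- `f(x) = ∏_{n=0}^∞ (1 − xq^{4n})(1 − xq^{4n+4})/(1 − xq^{4n+2})²`. -/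
def fProd (q x : ℂ) : ℂ :=
  ∏' n : ℕ, ((1 - x * q ^ (4 * n)) * (1 - x * q ^ (4 * n + 4)) / (1 - x * q ^ (4 * n + 2)) ^ 2)

/-- The `m`-th Taylor coefficient at `0` of the ratio `t ↦ f(t·q^a)/f(t·q^b)`,
where `q^c := exp(h·c)`; this is the coefficientwise expansion of the ratio of
`f`-series as a power series in `t = w/z`. -/
def ratioCoeff (h a b : ℂ) (m : ℕ) : ℂ :=
  iteratedDeriv m (fun t => fProd (Complex.exp h) (t * Complex.exp (h * a)) /
    fProd (Complex.exp h) (t * Complex.exp (h * b))) 0 / (m.factorial : ℂ)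

/-- Generators of `U_h(ĝl₂)_k`: `E[n]`, `F[n]` (`n ∈ ℤ`), and the modes
`k_i^+[−n]`, `k_i^−[n]` (`i = 1,2`, `n ≥ 0`). -/
inductive GlGen : Type
  | E : ℤ → GlGen
  | F : ℤ → GlGen
  | Kp : Fin 2 → ℕ → GlGen
  | Km : Fin 2 → ℕ → GlGen

/-- The free algebra on the generators. -/
abbrev GlFA : Type := FreeAlgebra ℂ GlGen

/-- `E[n]`. -/
def eG (n : ℤ) : GlFA := FreeAlgebra.ι ℂ (GlGen.E n)
/-- `F[n]`. -/
def fG (n : ℤ) : GlFA := FreeAlgebra.ι ℂ (GlGen.F n)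
/-- The coefficient of `zⁿ` in `k_i^+(z)` (zero for `n < 0`). -/
def kpG (i : Fin 2) (n : ℤ) : GlFA := if 0 ≤ n then FreeAlgebra.ι ℂ (GlGen.Kp i n.toNat) else 0
/-- The coefficient of `z⁻ⁿ` in `k_i^−(z)` (zero for `n < 0`). -/
def kmG (i : Fin 2) (n : ℤ) : GlFA := if 0 ≤ n then FreeAlgebra.ι ℂ (GlGen.Km i n.toNat) else 0

/-- Coefficients of the multiplicative inverse of a power series `Σ_{n≥0} a_n tⁿ`
with prescribed inverse `a0'` of the constant term:  `b₀ = a0'`,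
`b_{n+1} = −a0'·Σ_{j≤n} a_{n+1−j} b_j`. -/
def seriesInv {R : Type*} [Ring R] (a : ℕ → R) (a0' : R) : ℕ → R
  | 0 => a0'
  | n + 1 => -(a0' * ∑ j ∈ (Finset.range (n + 1)).attach,
      a (n + 1 - j.1) * seriesInv a a0' j.1)
termination_by n => n
decreasing_by exact Finset.mem_range.mp j.2

/-- Coefficients of `k₁^+(z)⁻¹` (formal inverse, with `k₁^+[0]⁻¹ = k₁^−[0]`). -/
def invKp1 : ℕ → GlFA := seriesInv (fun n => kpG 0 n) (kmG 0 0)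
/-- Coefficients of `k₁^−(z)⁻¹` (formal inverse, with `k₁^−[0]⁻¹ = k₁^+[0]`). -/
def invKm1 : ℕ → GlFA := seriesInv (fun n => kmG 0 n) (kpG 0 0)

/-- The coefficient of `w⁻ᶜ` in `k₂^−(wq^{k/2})·k₁^−(wq^{k/2})⁻¹` (zero for `c < 0`). -/
def AmSer (h k : ℂ) (c : ℤ) : GlFA :=
  if 0 ≤ c then
    Complex.exp (-(h * k) / 2 * (c : ℂ)) •
      ∑ j ∈ Finset.range (c.toNat + 1), kmG 1 (j : ℤ) * invKm1 (c.toNat - j)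
  else 0

/-- The coefficient of `wᶜ` in `k₂^+(wq^{−k/2})·k₁^+(wq^{−k/2})⁻¹` (zero for `c < 0`). -/
def ApSer (h k : ℂ) (c : ℤ) : GlFA :=
  if 0 ≤ c then
    Complex.exp (-(h * k) / 2 * (c : ℂ)) •
      ∑ j ∈ Finset.range (c.toNat + 1), kpG 1 (j : ℤ) * invKp1 (c.toNat - j)
  else 0

/-- The defining relations of `U_h(ĝl₂)_k`, written coefficientwise. -/
inductive GlRel (h k : ℂ) : GlFA → GlFA → Prop
  /- `k_i^+[0]k_i^−[0] = 1` -/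
  | kpkm0 (i : Fin 2) : GlRel h k (kpG i 0 * kmG i 0) 1
  /- `k_i^−[0]k_i^+[0] = 1` -/
  | kmkp0 (i : Fin 2) : GlRel h k (kmG i 0 * kpG i 0) 1
  /- `k_i^+(z)k_j^+(w) = k_j^+(w)k_i^+(z)` -/
  | kpkp (i j : Fin 2) (a b : ℤ) : GlRel h k (kpG i a * kpG j b) (kpG j b * kpG i a)
  /- `k_i^−(z)k_j^−(w) = k_j^−(w)k_i^−(z)` -/
  | kmkm (i j : Fin 2) (a b : ℤ) : GlRel h k (kmG i a * kmG j b) (kmG j b * kmG i a)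
  /- `k_i^−(z)k_i^+(w) = (f((w/z)q^{−k})/f((w/z)q^k))·k_i^+(w)k_i^−(z)`,
     coefficient of `z⁻ᵃwᵇ`. -/
  | kmkp_diag (i : Fin 2) (a b : ℕ) : GlRel h k (kmG i (a : ℤ) * kpG i (b : ℤ))
      (∑ m ∈ Finset.range (min a b + 1),
        ratioCoeff h (-k) k m • (kpG i ((b : ℤ) - m) * kmG i ((a : ℤ) - m)))
  /- `k₁^−(z)k₂^+(w) = (f((w/z)q^{k+2})/f((w/z)q^{−k+2}))·k₂^+(w)k₁^−(z)` -/
  | km1kp2 (a b : ℕ) : GlRel h k (kmG 0 (a : ℤ) * kpG 1 (b : ℤ))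
      (∑ m ∈ Finset.range (min a b + 1),
        ratioCoeff h (k + 2) (-k + 2) m • (kpG 1 ((b : ℤ) - m) * kmG 0 ((a : ℤ) - m)))
  /- `k₂^−(z)k₁^+(w) = (f((w/z)q^{k−2})/f((w/z)q^{−k−2}))·k₁^+(w)k₂^−(z)` -/
  | km2kp1 (a b : ℕ) : GlRel h k (kmG 1 (a : ℤ) * kpG 0 (b : ℤ))
      (∑ m ∈ Finset.range (min a b + 1),
        ratioCoeff h (k - 2) (-k - 2) m • (kpG 0 ((b : ℤ) - m) * kmG 1 ((a : ℤ) - m)))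
  /- `(zq^{−k/2} − w)k₁^+(z)E(w) = (zq^{−k/2−1} − wq)E(w)k₁^+(z)`, coefficient of `zⁿw⁻ᵐ`. -/
  | kp1E (n m : ℤ) : GlRel h k
      (Complex.exp (h * (-k / 2)) • (kpG 0 (n - 1) * eG m) - kpG 0 n * eG (m + 1))
      (Complex.exp (h * (-k / 2 - 1)) • (eG m * kpG 0 (n - 1))
        - Complex.exp h • (eG (m + 1) * kpG 0 n))
  /- `(zq^{k/2} − w)k₁^−(z)E(w) = (zq^{k/2−1} − wq)E(w)k₁^−(z)`, coefficient of `z⁻ⁿw⁻ᵐ`. -/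
  | km1E (n m : ℤ) : GlRel h k
      (Complex.exp (h * (k / 2)) • (kmG 0 (n + 1) * eG m) - kmG 0 n * eG (m + 1))
      (Complex.exp (h * (k / 2 - 1)) • (eG m * kmG 0 (n + 1))
        - Complex.exp h • (eG (m + 1) * kmG 0 n))
  /- `(zq^{k/2−1} − wq)k₁^+(z)F(w) = (zq^{k/2} − w)F(w)k₁^+(z)` -/
  | kp1F (n m : ℤ) : GlRel h k
      (Complex.exp (h * (k / 2 - 1)) • (kpG 0 (n - 1) * fG m)
        - Complex.exp h • (kpG 0 n * fG (m + 1)))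
      (Complex.exp (h * (k / 2)) • (fG m * kpG 0 (n - 1)) - fG (m + 1) * kpG 0 n)
  /- `(zq^{−k/2−1} − wq)k₁^−(z)F(w) = (zq^{−k/2} − w)F(w)k₁^−(z)` -/
  | km1F (n m : ℤ) : GlRel h k
      (Complex.exp (h * (-k / 2 - 1)) • (kmG 0 (n + 1) * fG m)
        - Complex.exp h • (kmG 0 n * fG (m + 1)))
      (Complex.exp (h * (-k / 2)) • (fG m * kmG 0 (n + 1)) - fG (m + 1) * kmG 0 n)
  /- `(zq^{−k/2} − w)k₂^+(z)E(w) = (zq^{−k/2+1} − wq^{−1})E(w)k₂^+(z)` -/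
  | kp2E (n m : ℤ) : GlRel h k
      (Complex.exp (h * (-k / 2)) • (kpG 1 (n - 1) * eG m) - kpG 1 n * eG (m + 1))
      (Complex.exp (h * (-k / 2 + 1)) • (eG m * kpG 1 (n - 1))
        - Complex.exp (-h) • (eG (m + 1) * kpG 1 n))
  /- `(zq^{k/2} − w)k₂^−(z)E(w) = (zq^{k/2+1} − wq^{−1})E(w)k₂^−(z)` -/
  | km2E (n m : ℤ) : GlRel h k
      (Complex.exp (h * (k / 2)) • (kmG 1 (n + 1) * eG m) - kmG 1 n * eG (m + 1))
      (Complex.exp (h * (k / 2 + 1)) • (eG m * kmG 1 (n + 1))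
        - Complex.exp (-h) • (eG (m + 1) * kmG 1 n))
  /- `(zq^{k/2+1} − wq^{−1})k₂^+(z)F(w) = (zq^{k/2} − w)F(w)k₂^+(z)` -/
  | kp2F (n m : ℤ) : GlRel h k
      (Complex.exp (h * (k / 2 + 1)) • (kpG 1 (n - 1) * fG m)
        - Complex.exp (-h) • (kpG 1 n * fG (m + 1)))
      (Complex.exp (h * (k / 2)) • (fG m * kpG 1 (n - 1)) - fG (m + 1) * kpG 1 n)
  /- `(zq^{−k/2+1} − wq^{−1})k₂^−(z)F(w) = (zq^{−k/2} − w)F(w)k₂^−(z)` -/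
  | km2F (n m : ℤ) : GlRel h k
      (Complex.exp (h * (-k / 2 + 1)) • (kmG 1 (n + 1) * fG m)
        - Complex.exp (-h) • (kmG 1 n * fG (m + 1)))
      (Complex.exp (h * (-k / 2)) • (fG m * kmG 1 (n + 1)) - fG (m + 1) * kmG 1 n)
  /- `(z − wq²)E(z)E(w) = (zq² − w)E(w)E(z)`, coefficient of `z⁻ᵃw⁻ᵇ`. -/
  | EE (a b : ℤ) : GlRel h k
      (eG (a + 1) * eG b - Complex.exp (2 * h) • (eG a * eG (b + 1)))
      (Complex.exp (2 * h) • (eG b * eG (a + 1)) - eG (b + 1) * eG a)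
  /- `(zq² − w)F(z)F(w) = (z − wq²)F(w)F(z)` -/
  | FF (a b : ℤ) : GlRel h k
      (Complex.exp (2 * h) • (fG (a + 1) * fG b) - fG a * fG (b + 1))
      (fG b * fG (a + 1) - Complex.exp (2 * h) • (fG (b + 1) * fG a))
  /- `[E(z),F(w)] = (q−q⁻¹)(δ((w/z)qᵏ)k₂^−(wq^{k/2})k₁^−(wq^{k/2})⁻¹
        − δ((w/z)q⁻ᵏ)k₂^+(wq^{−k/2})k₁^+(wq^{−k/2})⁻¹)`, coefficient of `z⁻ᵃw⁻ᵇ`. -/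
  | EF (a b : ℤ) : GlRel h k
      (eG a * fG b - fG b * eG a)
      ((Complex.exp h - Complex.exp (-h)) •
        (Complex.exp (h * k * (a : ℂ)) • AmSer h k (a + b)
          - Complex.exp (-(h * k) * (a : ℂ)) • ApSer h k (-(a + b))))

/-- `U_h(ĝl₂)_k`: the quotient of the free algebra by the defining relations. -/
abbrev Uhgl2 (h k : ℂ) := RingQuot (GlRel h k)

/-- The canonical projection `GlFA → U_h(ĝl₂)_k`. -/
def glMk (h k : ℂ) : GlFA →ₐ[ℂ] Uhgl2 h k := RingQuot.mkAlgHom ℂ (GlRel h k)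

/-- The coefficient of `zⁿ` in `k₁^+(z)·k₂^+(zq^{−2}) − 1`. -/
def Cp (h : ℂ) (n : ℕ) : GlFA :=
  (∑ j ∈ Finset.range (n + 1),
      Complex.exp (-2 * h * ((n : ℂ) - (j : ℂ))) • (kpG 0 (j : ℤ) * kpG 1 ((n : ℤ) - j)))
    - (if n = 0 then 1 else 0)

/-- The coefficient of `z⁻ⁿ` in `k₁^−(z)·k₂^−(zq^{−2}) − 1`. -/
def Cm (h : ℂ) (n : ℕ) : GlFA :=
  (∑ j ∈ Finset.range (n + 1),
      Complex.exp (2 * h * ((n : ℂ) - (j : ℂ))) • (kmG 0 (j : ℤ) * kmG 1 ((n : ℤ) - j)))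
    - (if n = 0 then 1 else 0)

theorem iteratedDeriv_comp_const_mul_field (f : ℂ → ℂ) (c : ℂ) (n : ℕ) :
    iteratedDeriv n (fun t => f (c * t)) = fun t => c ^ n * iteratedDeriv n f (c * t) := by
  induction n with
  | zero => simp
  | succ n ih =>
    ext t
    rw [iteratedDeriv_succ, ih, iteratedDeriv_succ, deriv_const_mul_field]
    rw [deriv_comp_mul_left, smul_eq_mul, pow_succ, mul_assoc]

theorem ratioCoeff_add_add (h a b c : ℂ) (m : ℕ) :
    Complex.exp (h * c) ^ m * ratioCoeff h a b m = ratioCoeff h (a + c) (b + c) m := by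
  have key := congrFun (iteratedDeriv_comp_const_mul_field
    (fun t => fProd (Complex.exp h) (t * Complex.exp (h * a)) /
      fProd (Complex.exp h) (t * Complex.exp (h * b))) (Complex.exp (h * c)) m) 0
  simp only [mul_zero] at key
  rw [ratioCoeff, ratioCoeff, ← mul_div_assoc, ← key]
  congr 3
  ext t
  rw [mul_add, mul_add, Complex.exp_add, Complex.exp_add]
  congr 2 <;> ring

theorem fProd_zero (q : ℂ) : fProd q 0 = 1 := by
  simp [fProd]

theorem norm_fProd_factor_sub_one_le {a b x : ℂ} (ha : ‖a‖ ≤ 1) (hb : ‖b‖ ≤ 1)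
    (hx : ‖x‖ < 1 / 2) :
    ‖(1 - x * a) * (1 - x * (a * b ^ 2)) / (1 - x * (a * b)) ^ 2 - 1‖ ≤ 8 * ‖a‖ := by
  have hab : ‖x * (a * b)‖ ≤ 1 / 2 := by
    rw [norm_mul, norm_mul]
    have := mul_le_one₀ ha (norm_nonneg b) hb
    nlinarith [norm_nonneg x]
  have hden : 1 / 2 ≤ ‖1 - x * (a * b)‖ := by
    have := norm_sub_norm_le (1 : ℂ) (x * (a * b))
    rw [norm_one] at this
    linarith
  have hne : 1 - x * (a * b) ≠ 0 := norm_pos_iff.mp (by linarith)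
  have hid : (1 - x * a) * (1 - x * (a * b ^ 2)) / (1 - x * (a * b)) ^ 2 - 1
      = -(x * a * (1 - b) ^ 2) / (1 - x * (a * b)) ^ 2 := by
    rw [div_sub_one (pow_ne_zero 2 hne)]
    congr 1
    ring
  have hb2 : ‖1 - b‖ ≤ 2 := by
    have := norm_sub_le (1 : ℂ) b
    rw [norm_one] at this
    linarith
  rw [hid, norm_div, norm_neg, norm_mul, norm_mul, norm_pow, norm_pow,
    div_le_iff₀ (by positivity)]
  have h1 : ‖1 - b‖ ^ 2 ≤ 4 := by nlinarith [norm_nonneg (1 - b)]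
  have h2 : 1 / 4 ≤ ‖1 - x * (a * b)‖ ^ 2 := by nlinarith
  calc ‖x‖ * ‖a‖ * ‖1 - b‖ ^ 2 ≤ 1 / 2 * ‖a‖ * 4 := by gcongr
    _ = 8 * ‖a‖ * (1 / 4) := by ring
    _ ≤ 8 * ‖a‖ * ‖1 - x * (a * b)‖ ^ 2 := by gcongr

theorem contDiffAt_fProd {q : ℂ} (hq : ‖q‖ < 1) {n : WithTop ℕ∞} :
    ContDiffAt ℂ n (fProd q) 0 := by
  set g : ℕ → ℂ → ℂ := fun n x =>
    (1 - x * q ^ (4 * n)) * (1 - x * q ^ (4 * n + 4)) / (1 - x * q ^ (4 * n + 2)) ^ 2 - 1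
    with hg
  set K : Set ℂ := Metric.ball 0 (1 / 2)
  have hpow (m : ℕ) : ‖q ^ m‖ ≤ 1 := by
    rw [norm_pow]
    exact pow_le_one₀ (norm_nonneg q) hq.le
  have hbound (n : ℕ) (x : ℂ) (hx : x ∈ K) : ‖g n x‖ ≤ 8 * (‖q‖ ^ 4) ^ n := by
    have := norm_fProd_factor_sub_one_le (hpow (4 * n)) (hpow 2) (mem_ball_zero_iff.mp hx)
    rw [← pow_mul, ← pow_add, ← pow_add, norm_pow] at this
    rw [← pow_mul]
    exact this
  have hdiff (n : ℕ) : DifferentiableOn ℂ (g n) K := by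
    refine DifferentiableOn.sub_const ?_ _
    refine DifferentiableOn.div (by fun_prop) (by fun_prop) fun x hx => pow_ne_zero 2 ?_
    intro h0
    have h1 : ‖x * q ^ (4 * n + 2)‖ = 1 := by rw [← sub_eq_zero.mp h0, norm_one]
    rw [norm_mul] at h1
    have := mem_ball_zero_iff.mp hx
    nlinarith [hpow (4 * n + 2), norm_nonneg x]
  have hsum : Summable fun n : ℕ => 8 * (‖q‖ ^ 4) ^ n :=
    (summable_geometric_of_lt_one (by positivity)
      (pow_lt_one₀ (norm_nonneg q) hq (by norm_num))).mul_left 8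
  have hprod := hsum.hasProdLocallyUniformlyOn_nat_one_add (f := g) (K := K) Metric.isOpen_ball
    (Filter.Eventually.of_forall hbound) fun n => (hdiff n).continuousOn
  have hd : DifferentiableOn ℂ (fProd q) K := by
    have : fProd q = fun x => ∏' n, (1 + g n x) := by
      ext x
      simp [fProd, hg]
    rw [this]
    refine (hasProdLocallyUniformlyOn_iff_tendstoLocallyUniformlyOn.mp hprod).differentiableOn
      (Filter.Eventually.of_forall fun s => ?_) Metric.isOpen_ball
    exact DifferentiableOn.fun_finsetProd fun n _ => (hdiff n).const_add 1
  exact (hd.analyticAt (Metric.ball_mem_nhds 0 (by norm_num))).contDiffAt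

theorem sum_antidiagonal_ratioCoeff_mul {h : ℂ} (hh : h.re < 0) (a b : ℂ) (n : ℕ) :
    ∑ p ∈ antidiagonal n, ratioCoeff h a b p.1 * ratioCoeff h b a p.2
      = if n = 0 then 1 else 0 := by
  have hq : ‖Complex.exp h‖ < 1 := by
    rw [Complex.norm_exp]
    exact Real.exp_lt_one_iff.mpr hh
  set g : ℂ → ℂ → ℂ := fun c t => fProd (Complex.exp h) (t * Complex.exp (h * c)) with hg
  have hr (a b : ℂ) (m : ℕ) : ratioCoeff h a b m =
      iteratedDeriv m (fun t => g a t / g b t) 0 / m.factorial := rfl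
  have hsmooth (c : ℂ) : ContDiffAt ℂ n (g c) 0 := by
    refine ContDiffAt.comp (g := fProd (Complex.exp h)) (0 : ℂ) ?_ (by fun_prop)
    rw [zero_mul]
    exact contDiffAt_fProd hq
  have hg0 (c : ℂ) : g c 0 = 1 := by simp [hg, fProd_zero]
  have hne (c : ℂ) : g c 0 ≠ 0 := by simp [hg0]
  have hprod : (fun t => g a t / g b t) * (fun t => g b t / g a t) =ᶠ[nhds 0] fun _ => 1 := by
    filter_upwards [(hsmooth a).continuousAt.eventually_ne (hne a),
      (hsmooth b).continuousAt.eventually_ne (hne b)] with t hta htb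
    simp only [Pi.mul_apply]
    field_simp
  have hderiv := hprod.iteratedDeriv_eq n
  rw [iteratedDeriv_mul ((hsmooth a).fun_div (hsmooth b) (hne b))
    ((hsmooth b).fun_div (hsmooth a) (hne a)), iteratedDeriv_const] at hderiv
  have hfac : (n.factorial : ℂ) ≠ 0 := by exact_mod_cast n.factorial_ne_zero
  rw [Nat.sum_antidiagonal_eq_sum_range_succ (fun i j => ratioCoeff h a b i * ratioCoeff h b a j)]
  have : ∀ i ∈ range (n + 1), ratioCoeff h a b i * ratioCoeff h b a (n - i) =
      (n.choose i * iteratedDeriv i (fun t => g a t / g b t) 0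
        * iteratedDeriv (n - i) (fun t => g b t / g a t) 0) / n.factorial := by
    intro i hi
    rw [Nat.cast_choose ℂ (Nat.lt_succ_iff.mp (mem_range.mp hi)), hr, hr]
    have h1 : (i.factorial : ℂ) ≠ 0 := by exact_mod_cast i.factorial_ne_zero
    have h2 : ((n - i).factorial : ℂ) ≠ 0 := by exact_mod_cast (n - i).factorial_ne_zero
    field_simp
  rw [sum_congr rfl this, ← sum_div, hderiv]
  split_ifs with hn <;> simp [hn]

section FormalSeries

open PowerSeries

variable {A : Type*} [Ring A]

/-- The power series formed by the nonnegatively indexed terms of a sequence. -/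
def nonnegSeries (x : ℤ → A) : A⟦X⟧ := mk fun n : ℕ => x n

theorem commute_coeff_mul {x₁ x₂ : ℤ → A} {y : A} (h₁ : ∀ n, Commute (x₁ n) y)
    (h₂ : ∀ n, Commute (x₂ n) y) (n : ℕ) :
    Commute (coeff n (nonnegSeries x₁ * nonnegSeries x₂)) y := by
  rw [coeff_mul]
  refine Commute.sum_left _ _ _ fun p _ => ?_
  simpa [nonnegSeries] using (h₁ _).mul_left (h₂ _)

variable [Algebra ℂ A]

/-- Rescaling the formal variable by `s`, on coefficients. -/
def rescaleSeq (s : ℂ) (x : ℤ → A) (n : ℤ) : A := s ^ n • x n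

/-- `z`-series relations of the form `(az − bw)k(z)e(w) = (cz − dw)e(w)k(z)`, coefficientwise. -/
def Intertwines (k e : ℤ → A) (a b c d : ℂ) : Prop :=
  ∀ n m : ℤ, a • (k (n - 1) * e m) - b • (k n * e (m + 1))
    = c • (e m * k (n - 1)) - d • (e (m + 1) * k n)

theorem Intertwines.rescaleSeq {k e : ℤ → A} {a b c d : ℂ} (hk : Intertwines k e a b c d)
    {s : ℂ} (hs : s ≠ 0) : Intertwines (rescaleSeq s k) e (a * s) b (c * s) d := by
  intro n m
  have h := congrArg (s ^ n • ·) (hk n m)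
  simp only [smul_sub, smul_smul] at h
  have hsn : s * s ^ (n - 1) = s ^ n := by rw [mul_comm, zpow_sub_one₀ hs, inv_mul_cancel_right₀ hs]
  simp only [_root_.rescaleSeq, smul_mul_assoc, mul_smul_comm, smul_smul, mul_assoc, hsn]
  simpa only [mul_comm (s ^ n)] using h

theorem Intertwines.reflect {k e : ℤ → A} {a b c d : ℂ}
    (hk : ∀ n m : ℤ, a • (k (n + 1) * e m) - b • (k n * e (m + 1))
      = c • (e m * k (n + 1)) - d • (e (m + 1) * k n)) :
    Intertwines k (fun m => e (-m)) b a d c := by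
  intro n m
  have h := hk (n - 1) (-(m + 1))
  rw [sub_add_cancel, show -(m + 1) + 1 = -m by ring] at h
  rw [← neg_sub, h, neg_sub]

theorem Intertwines.nonnegSeries {k e : ℤ → A} {a b c d : ℂ} (hk : Intertwines k e a b c d)
    (hneg : ∀ n < 0, k n = 0) (m : ℤ) :
    a • (X * (nonnegSeries k * C (e m))) - b • (nonnegSeries k * C (e (m + 1)))
      = c • (X * (C (e m) * nonnegSeries k)) - d • (C (e (m + 1)) * nonnegSeries k) := by
  ext n
  cases n with
  | zero =>
    have h := hk 0 m
    rw [hneg (0 - 1) (by norm_num)] at h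
    simpa [_root_.nonnegSeries] using h
  | succ n =>
    have h := hk (n + 1) m
    rw [add_sub_cancel_right] at h
    simpa [_root_.nonnegSeries, coeff_succ_X_mul, coeff_mul_C, coeff_C_mul] using h

theorem Intertwines.commute_coeff {k₁ k₂ e : ℤ → A} {a b c d l : ℂ}
    (h₁ : Intertwines k₁ e a b c d) (h₂ : Intertwines k₂ e (l * c) (l * d) (l * a) (l * b))
    (hneg₁ : ∀ n < 0, k₁ n = 0) (hneg₂ : ∀ n < 0, k₂ n = 0) (hld : l * d ≠ 0) (n : ℕ) (m : ℤ) :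
    Commute (coeff n (_root_.nonnegSeries k₁ * _root_.nonnegSeries k₂)) (e m) := by
  set K₁ := _root_.nonnegSeries k₁
  set K₂ := _root_.nonnegSeries k₂
  have key (m : ℤ) : (l * d) • (K₁ * K₂ * C (e (m + 1)) - C (e (m + 1)) * (K₁ * K₂))
      = (l * c) • (X * (K₁ * K₂ * C (e m) - C (e m) * (K₁ * K₂))) := by
    have e₁ := congrArg (fun x => l • (x * K₂)) (h₁.nonnegSeries hneg₁ m)
    have e₂ := congrArg (K₁ * ·) (h₂.nonnegSeries hneg₂ m)
    have hX (x : A⟦X⟧) : K₁ * (X * x) = X * (K₁ * x) := by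
      rw [← mul_assoc, ← X_mul, mul_assoc]
    simp only [mul_sub, sub_mul, smul_sub, smul_mul_assoc, mul_smul_comm, smul_smul, hX,
      mul_assoc] at e₁ e₂ ⊢
    have e₃ := e₂.trans e₁
    rw [sub_eq_sub_iff_add_eq_add] at e₃ ⊢
    rw [add_comm, ← e₃, add_comm]
  have hstep (n : ℕ) (m : ℤ) : (l * d) • (coeff n (K₁ * K₂) * e (m + 1)
      - e (m + 1) * coeff n (K₁ * K₂))
      = coeff n ((l * c) • (X * (K₁ * K₂ * C (e m) - C (e m) * (K₁ * K₂)))) := by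
    rw [← key m]
    simp only [map_sub, coeff_smul, coeff_mul_C, coeff_C_mul]
  induction n generalizing m with
  | zero =>
    have h := hstep 0 (m - 1)
    rw [sub_add_cancel, coeff_smul, coeff_zero_X_mul, smul_zero] at h
    exact sub_eq_zero.mp ((smul_eq_zero_iff_right hld).mp h)
  | succ n ih =>
    have h := hstep (n + 1) (m - 1)
    rw [sub_add_cancel, coeff_smul, coeff_succ_X_mul, map_sub, coeff_mul_C, coeff_C_mul,
      (ih (m - 1)).eq, sub_self, smul_zero] at h
    exact sub_eq_zero.mp ((smul_eq_zero_iff_right hld).mp h)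

/-- Relations of the form `y(z)x(w) = r(w/z)·x(w)y(z)`, coefficientwise, for a series `y` in
`z⁻¹` and a series `x` in `w`. -/
def ExchangeRel (y x : ℤ → A) (r : ℕ → ℂ) : Prop :=
  ∀ a b : ℕ, y a * x b = ∑ m ∈ range (min a b + 1), r m • (x ((b : ℤ) - m) * y ((a : ℤ) - m))

theorem ExchangeRel.rescaleSeq_right {y x : ℤ → A} {r : ℕ → ℂ} (hyx : ExchangeRel y x r)
    {s : ℂ} (hs : s ≠ 0) : ExchangeRel y (rescaleSeq s x) fun m => s ^ m * r m := by
  intro a b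
  simp only [rescaleSeq, mul_smul_comm, smul_mul_assoc, hyx a b, smul_sum, smul_smul]
  refine sum_congr rfl fun m _ => ?_
  rw [zpow_sub₀ hs, zpow_natCast, zpow_natCast]
  congr 1
  field_simp

theorem ExchangeRel.rescaleSeq_left {y x : ℤ → A} {r : ℕ → ℂ} (hyx : ExchangeRel y x r)
    {s : ℂ} (hs : s ≠ 0) : ExchangeRel (rescaleSeq s y) x fun m => s ^ m * r m := by
  intro a b
  simp only [rescaleSeq, mul_smul_comm, smul_mul_assoc, hyx a b, smul_sum, smul_smul]
  refine sum_congr rfl fun m _ => ?_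
  rw [zpow_sub₀ hs, zpow_natCast, zpow_natCast]
  congr 1
  field_simp

/-- The series `r(wu)` in the two formal variables `u` (outer) and `w` (inner). -/
def diagSeries (A : Type*) [Ring A] [Algebra ℂ A] (r : ℕ → ℂ) : A⟦X⟧⟦X⟧ :=
  mk fun m => r m • X ^ m

theorem diagSeries_commute (r : ℕ → ℂ) (F : A⟦X⟧⟦X⟧) : Commute (diagSeries A r) F := by
  refine PowerSeries.ext fun n => ?_
  rw [coeff_mul, coeff_mul, ← Nat.sum_antidiagonal_swap]
  refine sum_congr rfl fun p _ => ?_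
  simp only [diagSeries, coeff_mk, Prod.fst_swap, Prod.snd_swap, smul_mul_assoc, mul_smul_comm,
    (commute_X_pow _ _).eq]

theorem diagSeries_mul_eq_one {r r' : ℕ → ℂ}
    (hr : ∀ n, ∑ p ∈ antidiagonal n, r p.1 * r' p.2 = if n = 0 then 1 else 0) :
    diagSeries A r * diagSeries A r' = 1 := by
  refine PowerSeries.ext fun n => ?_
  have : ∀ p ∈ antidiagonal n, coeff p.1 (diagSeries A r) * coeff p.2 (diagSeries A r')
      = (r p.1 * r' p.2) • (X : A⟦X⟧) ^ n := by
    intro p hp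
    rw [← mem_antidiagonal.mp hp, pow_add]
    simp only [diagSeries, coeff_mk, smul_mul_smul_comm]
  rw [coeff_mul, sum_congr rfl this, ← sum_smul, hr, coeff_one]
  split_ifs with hn <;> simp [hn]

theorem ExchangeRel.series_mul {y x : ℤ → A} {r : ℕ → ℂ} (hyx : ExchangeRel y x r) :
    PowerSeries.map C (nonnegSeries y) * C (nonnegSeries x)
      = diagSeries A r * (C (nonnegSeries x) * PowerSeries.map C (nonnegSeries y)) := by
  refine PowerSeries.ext fun a => PowerSeries.ext fun b => ?_
  rw [coeff_mul_C, coeff_map, coeff_C_mul, coeff_mul, map_sum,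
    Nat.sum_antidiagonal_eq_sum_range_succ_mk]
  simp only [nonnegSeries, diagSeries, coeff_mk, coeff_C_mul, coeff_map, smul_mul_assoc,
    coeff_smul, coeff_X_pow_mul', coeff_mul_C]
  rw [hyx a b]
  have hsub : range (min a b + 1) ⊆ range (a + 1) := range_subset_range.mpr (by omega)
  rw [← sum_subset hsub]
  · refine sum_congr rfl fun m hm => ?_
    have := mem_range.mp hm
    rw [if_pos (by omega), Nat.cast_sub (by omega), Nat.cast_sub (by omega)]
  · intro m hm hm'
    have := mem_range.mp hm
    have : ¬ m < min a b + 1 := fun h => hm' (mem_range.mpr h)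
    rw [if_neg (by omega), smul_zero]

theorem ExchangeRel.commute_coeff_right {y x₁ x₂ : ℤ → A} {r₁ r₂ : ℕ → ℂ}
    (h₁ : ExchangeRel y x₁ r₁) (h₂ : ExchangeRel y x₂ r₂)
    (hr : ∀ n, ∑ p ∈ antidiagonal n, r₁ p.1 * r₂ p.2 = if n = 0 then 1 else 0) (n a : ℕ) :
    Commute (coeff n (nonnegSeries x₁ * nonnegSeries x₂)) (y a) := by
  have key : PowerSeries.map C (nonnegSeries y) * C (nonnegSeries x₁ * nonnegSeries x₂)
      = C (nonnegSeries x₁ * nonnegSeries x₂) * PowerSeries.map C (nonnegSeries y) := by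
    rw [map_mul, ← mul_assoc, h₁.series_mul, mul_assoc, mul_assoc, h₂.series_mul,
      ← mul_assoc (C _) (diagSeries A r₂), ← (diagSeries_commute r₂ _).eq, mul_assoc,
      ← mul_assoc, diagSeries_mul_eq_one hr, one_mul, mul_assoc]
  have := congrArg (fun F => coeff n (coeff a F)) key
  simp only [coeff_mul_C, coeff_C_mul, coeff_map] at this
  exact (by simpa [nonnegSeries] using this.symm : _ * _ = _ * _)

theorem ExchangeRel.commute_coeff_left {y₁ y₂ x : ℤ → A} {r₁ r₂ : ℕ → ℂ}
    (h₁ : ExchangeRel y₁ x r₁) (h₂ : ExchangeRel y₂ x r₂)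
    (hr : ∀ n, ∑ p ∈ antidiagonal n, r₁ p.1 * r₂ p.2 = if n = 0 then 1 else 0) (n b : ℕ) :
    Commute (coeff n (nonnegSeries y₁ * nonnegSeries y₂)) (x b) := by
  have key : PowerSeries.map C (nonnegSeries y₁ * nonnegSeries y₂) * C (nonnegSeries x)
      = C (nonnegSeries x) * PowerSeries.map C (nonnegSeries y₁ * nonnegSeries y₂) := by
    rw [map_mul, mul_assoc, h₂.series_mul, ← mul_assoc, ← (diagSeries_commute r₂ _).eq, mul_assoc,
      ← mul_assoc (PowerSeries.map C _) (C _), h₁.series_mul, mul_assoc (diagSeries A r₁),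
      ← mul_assoc (diagSeries A r₂), (diagSeries_commute r₂ _).eq, diagSeries_mul_eq_one hr,
      one_mul, mul_assoc]
  have := congrArg (fun F => coeff b (coeff n F)) key
  simp only [coeff_mul_C, coeff_C_mul, coeff_map] at this
  exact (by simpa [nonnegSeries] using this : _ * _ = _ * _)

end FormalSeries

theorem glMk_rel {h k : ℂ} {x y : GlFA} (hxy : GlRel h k x y) : glMk h k x = glMk h k y :=
  RingQuot.mkAlgHom_rel ℂ hxy

theorem kpG_of_neg (i : Fin 2) {n : ℤ} (hn : n < 0) : kpG i n = 0 := if_neg (by omega)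

theorem kmG_of_neg (i : Fin 2) {n : ℤ} (hn : n < 0) : kmG i n = 0 := if_neg (by omega)

theorem glMk_commute_of_generators {h k : ℂ} {z : Uhgl2 h k}
    (hE : ∀ n, Commute z (glMk h k (eG n))) (hF : ∀ n, Commute z (glMk h k (fG n)))
    (hKp : ∀ i, ∀ n : ℕ, Commute z (glMk h k (kpG i n)))
    (hKm : ∀ i, ∀ n : ℕ, Commute z (glMk h k (kmG i n))) (x : Uhgl2 h k) : Commute z x := by
  obtain ⟨y, rfl⟩ := RingQuot.mkAlgHom_surjective ℂ (GlRel h k) x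
  change Commute z (glMk h k y)
  induction y using FreeAlgebra.induction with
  | grade0 r => rw [AlgHom.commutes]; exact (Algebra.commutes r z).symm
  | grade1 g =>
    cases g with
    | E n => exact hE n
    | F n => exact hF n
    | Kp i n => simpa [kpG] using hKp i n
    | Km i n => simpa [kmG] using hKm i n
  | mul a b ha hb => rw [map_mul]; exact ha.mul_right hb
  | add a b ha hb => rw [map_add]; exact ha.add_right hb

section Images

variable (h k : ℂ)

/-- The image of `k_i^+` in `U_h(ĝl₂)_k`. -/
def kpU (i : Fin 2) (n : ℤ) : Uhgl2 h k := glMk h k (kpG i n)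

/-- The image of `k_i^−` in `U_h(ĝl₂)_k`. -/
def kmU (i : Fin 2) (n : ℤ) : Uhgl2 h k := glMk h k (kmG i n)

theorem glMk_Cp (n : ℕ) : glMk h k (Cp h n) =
    PowerSeries.coeff n (nonnegSeries (kpU h k 0) *
      nonnegSeries (rescaleSeq (Complex.exp (h * -2)) (kpU h k 1))) - if n = 0 then 1 else 0 := by
  rw [Cp, map_sub, map_sum, PowerSeries.coeff_mul, Nat.sum_antidiagonal_eq_sum_range_succ_mk,
    apply_ite (glMk h k), map_one, map_zero]
  congr 1
  refine sum_congr rfl fun j hj => ?_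
  have hj := Nat.lt_succ_iff.mp (mem_range.mp hj)
  rw [map_smul, map_mul, nonnegSeries, nonnegSeries, PowerSeries.coeff_mk, PowerSeries.coeff_mk,
    rescaleSeq, mul_smul_comm, zpow_natCast, ← Complex.exp_nat_mul, Nat.cast_sub hj,
    Nat.cast_sub hj]
  congr 2
  ring

theorem glMk_Cm (n : ℕ) : glMk h k (Cm h n) =
    PowerSeries.coeff n (nonnegSeries (kmU h k 0) *
      nonnegSeries (rescaleSeq (Complex.exp (h * 2)) (kmU h k 1))) - if n = 0 then 1 else 0 := by
  rw [Cm, map_sub, map_sum, PowerSeries.coeff_mul, Nat.sum_antidiagonal_eq_sum_range_succ_mk,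
    apply_ite (glMk h k), map_one, map_zero]
  congr 1
  refine sum_congr rfl fun j hj => ?_
  have hj := Nat.lt_succ_iff.mp (mem_range.mp hj)
  rw [map_smul, map_mul, nonnegSeries, nonnegSeries, PowerSeries.coeff_mk, PowerSeries.coeff_mk,
    rescaleSeq, mul_smul_comm, zpow_natCast, ← Complex.exp_nat_mul, Nat.cast_sub hj,
    Nat.cast_sub hj]
  congr 2
  ring

variable {h k}

theorem kpU_of_neg (i : Fin 2) {n : ℤ} (hn : n < 0) : kpU h k i n = 0 := by
  rw [kpU, kpG_of_neg i hn, map_zero]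

theorem kmU_of_neg (i : Fin 2) {n : ℤ} (hn : n < 0) : kmU h k i n = 0 := by
  rw [kmU, kmG_of_neg i hn, map_zero]

theorem rescaleSeq_of_neg {A : Type*} [Ring A] [Algebra ℂ A] {x : ℤ → A}
    (hx : ∀ n < 0, x n = 0) (s : ℂ) (n : ℤ) (hn : n < 0) : rescaleSeq s x n = 0 := by
  rw [rescaleSeq, hx n hn, smul_zero]

theorem commute_rescaleSeq {A : Type*} [Ring A] [Algebra ℂ A] {x : ℤ → A} {y : A}
    (hx : ∀ n, Commute (x n) y) (s : ℂ) (n : ℤ) : Commute (rescaleSeq s x n) y :=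
  (hx n).smul_left _

theorem kpU_commute (i j : Fin 2) (a b : ℤ) : Commute (kpU h k i a) (kpU h k j b) := by
  simpa only [commute_iff_eq, kpU, map_mul] using glMk_rel (GlRel.kpkp (h := h) (k := k) i j a b)

theorem kmU_commute (i j : Fin 2) (a b : ℤ) : Commute (kmU h k i a) (kmU h k j b) := by
  simpa only [commute_iff_eq, kmU, map_mul] using glMk_rel (GlRel.kmkm (h := h) (k := k) i j a b)

theorem exchangeRel_diag (i : Fin 2) :
    ExchangeRel (kmU h k i) (kpU h k i) (ratioCoeff h (-k) k) := fun a b => by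
  simpa only [kpU, kmU, map_mul, map_sum, map_smul] using
    glMk_rel (GlRel.kmkp_diag (h := h) (k := k) i a b)

theorem exchangeRel_km1_kp2 :
    ExchangeRel (kmU h k 0) (kpU h k 1) (ratioCoeff h (k + 2) (-k + 2)) := fun a b => by
  simpa only [kpU, kmU, map_mul, map_sum, map_smul] using
    glMk_rel (GlRel.km1kp2 (h := h) (k := k) a b)

theorem exchangeRel_km2_kp1 :
    ExchangeRel (kmU h k 1) (kpU h k 0) (ratioCoeff h (k - 2) (-k - 2)) := fun a b => by
  simpa only [kpU, kmU, map_mul, map_sum, map_smul] using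
    glMk_rel (GlRel.km2kp1 (h := h) (k := k) a b)

theorem sum_antidiagonal_ratioCoeff_mul_rescaled (hh : h.re < 0) {a b a' b' c : ℂ}
    (ha : a' + c = b) (hb : b' + c = a) (n : ℕ) :
    ∑ p ∈ antidiagonal n, ratioCoeff h a b p.1 *
      (Complex.exp (h * c) ^ p.2 * ratioCoeff h a' b' p.2) = if n = 0 then 1 else 0 := by
  simp only [ratioCoeff_add_add, ha, hb]
  exact sum_antidiagonal_ratioCoeff_mul hh a b n

theorem coeff_kp_commute_km (hh : h.re < 0) (n : ℕ) (i : Fin 2) (a : ℕ) :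
    Commute (PowerSeries.coeff n (nonnegSeries (kpU h k 0) *
      nonnegSeries (rescaleSeq (Complex.exp (h * -2)) (kpU h k 1)))) (kmU h k i a) := by
  have hs := Complex.exp_ne_zero (h * -2)
  fin_cases i
  · exact (exchangeRel_diag 0).commute_coeff_right (exchangeRel_km1_kp2.rescaleSeq_right hs)
      (sum_antidiagonal_ratioCoeff_mul_rescaled hh (by ring) (by ring)) n a
  · exact exchangeRel_km2_kp1.commute_coeff_right ((exchangeRel_diag 1).rescaleSeq_right hs)
      (sum_antidiagonal_ratioCoeff_mul_rescaled hh (by ring) (by ring)) n a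

theorem coeff_km_commute_kp (hh : h.re < 0) (n : ℕ) (i : Fin 2) (b : ℕ) :
    Commute (PowerSeries.coeff n (nonnegSeries (kmU h k 0) *
      nonnegSeries (rescaleSeq (Complex.exp (h * 2)) (kmU h k 1)))) (kpU h k i b) := by
  have hs := Complex.exp_ne_zero (h * 2)
  fin_cases i
  · exact (exchangeRel_diag 0).commute_coeff_left (exchangeRel_km2_kp1.rescaleSeq_left hs)
      (sum_antidiagonal_ratioCoeff_mul_rescaled hh (by ring) (by ring)) n b
  · exact exchangeRel_km1_kp2.commute_coeff_left ((exchangeRel_diag 1).rescaleSeq_left hs)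
      (sum_antidiagonal_ratioCoeff_mul_rescaled hh (by ring) (by ring)) n b

theorem coeff_kp_commute_of_intertwines {e : ℤ → Uhgl2 h k} {a b c d a' b' c' d' l : ℂ}
    (h₁ : Intertwines (kpU h k 0) e a b c d) (h₂ : Intertwines (kpU h k 1) e a' b' c' d')
    (ha : a' * Complex.exp (h * -2) = l * c) (hb : b' = l * d)
    (hc : c' * Complex.exp (h * -2) = l * a) (hd : d' = l * b) (hne : l * d ≠ 0)
    (n : ℕ) (m : ℤ) :
    Commute (PowerSeries.coeff n (nonnegSeries (kpU h k 0) *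
      nonnegSeries (rescaleSeq (Complex.exp (h * -2)) (kpU h k 1)))) (e m) := by
  have h₂' := h₂.rescaleSeq (Complex.exp_ne_zero (h * -2))
  rw [ha, hb, hc, hd] at h₂'
  exact h₁.commute_coeff h₂' (fun _ => kpU_of_neg 0)
    (rescaleSeq_of_neg (fun _ => kpU_of_neg 1) _) hne n m

theorem coeff_km_commute_of_intertwines {e : ℤ → Uhgl2 h k} {a b c d a' b' c' d' l : ℂ}
    (h₁ : Intertwines (kmU h k 0) e a b c d) (h₂ : Intertwines (kmU h k 1) e a' b' c' d')
    (ha : a' * Complex.exp (h * 2) = l * c) (hb : b' = l * d)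
    (hc : c' * Complex.exp (h * 2) = l * a) (hd : d' = l * b) (hne : l * d ≠ 0)
    (n : ℕ) (m : ℤ) :
    Commute (PowerSeries.coeff n (nonnegSeries (kmU h k 0) *
      nonnegSeries (rescaleSeq (Complex.exp (h * 2)) (kmU h k 1)))) (e m) := by
  have h₂' := h₂.rescaleSeq (Complex.exp_ne_zero (h * 2))
  rw [ha, hb, hc, hd] at h₂'
  exact h₁.commute_coeff h₂' (fun _ => kmU_of_neg 0)
    (rescaleSeq_of_neg (fun _ => kmU_of_neg 1) _) hne n m

theorem intertwines_kp1_E : Intertwines (kpU h k 0) (fun m => glMk h k (eG m))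
    (Complex.exp (h * (-k / 2))) 1 (Complex.exp (h * (-k / 2 - 1))) (Complex.exp h) := fun n m => by
  simpa only [kpU, map_sub, map_smul, map_mul, one_smul] using
    glMk_rel (GlRel.kp1E (h := h) (k := k) n m)

theorem intertwines_kp2_E : Intertwines (kpU h k 1) (fun m => glMk h k (eG m))
    (Complex.exp (h * (-k / 2))) 1 (Complex.exp (h * (-k / 2 + 1))) (Complex.exp (-h)) :=
  fun n m => by
  simpa only [kpU, map_sub, map_smul, map_mul, one_smul] using
    glMk_rel (GlRel.kp2E (h := h) (k := k) n m)

theorem intertwines_kp1_F : Intertwines (kpU h k 0) (fun m => glMk h k (fG m))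
    (Complex.exp (h * (k / 2 - 1))) (Complex.exp h) (Complex.exp (h * (k / 2))) 1 := fun n m => by
  simpa only [kpU, map_sub, map_smul, map_mul, one_smul] using
    glMk_rel (GlRel.kp1F (h := h) (k := k) n m)

theorem intertwines_kp2_F : Intertwines (kpU h k 1) (fun m => glMk h k (fG m))
    (Complex.exp (h * (k / 2 + 1))) (Complex.exp (-h)) (Complex.exp (h * (k / 2))) 1 :=
  fun n m => by
  simpa only [kpU, map_sub, map_smul, map_mul, one_smul] using
    glMk_rel (GlRel.kp2F (h := h) (k := k) n m)

theorem intertwines_km1_E : Intertwines (kmU h k 0) (fun m => glMk h k (eG (-m)))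
    1 (Complex.exp (h * (k / 2))) (Complex.exp h) (Complex.exp (h * (k / 2 - 1))) :=
  Intertwines.reflect (e := fun m => glMk h k (eG m)) fun n m => by
  simpa only [kmU, map_sub, map_smul, map_mul, one_smul] using
    glMk_rel (GlRel.km1E (h := h) (k := k) n m)

theorem intertwines_km2_E : Intertwines (kmU h k 1) (fun m => glMk h k (eG (-m)))
    1 (Complex.exp (h * (k / 2))) (Complex.exp (-h)) (Complex.exp (h * (k / 2 + 1))) :=
  Intertwines.reflect (e := fun m => glMk h k (eG m)) fun n m => by
  simpa only [kmU, map_sub, map_smul, map_mul, one_smul] using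
    glMk_rel (GlRel.km2E (h := h) (k := k) n m)

theorem intertwines_km1_F : Intertwines (kmU h k 0) (fun m => glMk h k (fG (-m)))
    (Complex.exp h) (Complex.exp (h * (-k / 2 - 1))) 1 (Complex.exp (h * (-k / 2))) :=
  Intertwines.reflect (e := fun m => glMk h k (fG m)) fun n m => by
  simpa only [kmU, map_sub, map_smul, map_mul, one_smul] using
    glMk_rel (GlRel.km1F (h := h) (k := k) n m)

theorem intertwines_km2_F : Intertwines (kmU h k 1) (fun m => glMk h k (fG (-m)))
    (Complex.exp (-h)) (Complex.exp (h * (-k / 2 + 1))) 1 (Complex.exp (h * (-k / 2))) :=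
  Intertwines.reflect (e := fun m => glMk h k (fG m)) fun n m => by
  simpa only [kmU, map_sub, map_smul, map_mul, one_smul] using
    glMk_rel (GlRel.km2F (h := h) (k := k) n m)

theorem coeff_kp_commute_E (n : ℕ) (m : ℤ) :
    Commute (PowerSeries.coeff n (nonnegSeries (kpU h k 0) *
      nonnegSeries (rescaleSeq (Complex.exp (h * -2)) (kpU h k 1)))) (glMk h k (eG m)) := by
  refine coeff_kp_commute_of_intertwines (l := Complex.exp (-h)) intertwines_kp1_E
    intertwines_kp2_E ?_ ?_ ?_ ?_ (by simp) n m <;> first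
    | rw [← Complex.exp_add, ← Complex.exp_add]; congr 1; ring
    | simp [← Complex.exp_add]

theorem coeff_kp_commute_F (n : ℕ) (m : ℤ) :
    Commute (PowerSeries.coeff n (nonnegSeries (kpU h k 0) *
      nonnegSeries (rescaleSeq (Complex.exp (h * -2)) (kpU h k 1)))) (glMk h k (fG m)) := by
  refine coeff_kp_commute_of_intertwines (l := Complex.exp (-h)) intertwines_kp1_F
    intertwines_kp2_F ?_ ?_ ?_ ?_ (by simp) n m <;> first
    | rw [← Complex.exp_add, ← Complex.exp_add]; congr 1; ring
    | simp [← Complex.exp_add]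

theorem coeff_km_commute_E (n : ℕ) (m : ℤ) :
    Commute (PowerSeries.coeff n (nonnegSeries (kmU h k 0) *
      nonnegSeries (rescaleSeq (Complex.exp (h * 2)) (kmU h k 1)))) (glMk h k (eG m)) := by
  rw [← neg_neg m]
  refine coeff_km_commute_of_intertwines (l := Complex.exp h) intertwines_km1_E
    intertwines_km2_E ?_ ?_ ?_ ?_ (by simp) n (-m) <;>
    simp only [← Complex.exp_add, mul_one, one_mul] <;> congr 1 <;> ring

theorem coeff_km_commute_F (n : ℕ) (m : ℤ) :
    Commute (PowerSeries.coeff n (nonnegSeries (kmU h k 0) *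
      nonnegSeries (rescaleSeq (Complex.exp (h * 2)) (kmU h k 1)))) (glMk h k (fG m)) := by
  rw [← neg_neg m]
  refine coeff_km_commute_of_intertwines (l := Complex.exp h) intertwines_km1_F
    intertwines_km2_F ?_ ?_ ?_ ?_ (by simp) n (-m) <;>
    simp only [← Complex.exp_add, mul_one, one_mul] <;> congr 1 <;> ring

end Images

/-- In `U_h(ĝl₂)_k`, every Fourier coefficient of the power series
`k₁^±(z)·k₂^±(zq^{−2}) − 1` is a central element. -/
theorem central_coefficients_Uhgl2 (h k : ℂ) (hh : h.re < 0) (n : ℕ) :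
    (∀ x : Uhgl2 h k, glMk h k (Cp h n) * x = x * glMk h k (Cp h n)) ∧
    (∀ x : Uhgl2 h k, glMk h k (Cm h n) * x = x * glMk h k (Cm h n)) := by
  have hone {z : Uhgl2 h k} (hz : ∀ x, Commute z x) (x : Uhgl2 h k) :
      (z - if n = 0 then 1 else 0) * x = x * (z - if n = 0 then 1 else 0) := by
    split_ifs
    · exact (hz x).sub_left (Commute.one_left x)
    · rw [sub_zero]; exact hz x
  refine ⟨?_, ?_⟩
  · rw [glMk_Cp]
    exact hone (glMk_commute_of_generators (coeff_kp_commute_E n) (coeff_kp_commute_F n)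
      (fun i m => commute_coeff_mul (fun a => kpU_commute 0 i a m)
        (commute_rescaleSeq (fun a => kpU_commute 1 i a m) _) n)
      (coeff_kp_commute_km hh n))
  · rw [glMk_Cm]
    exact hone (glMk_commute_of_generators (coeff_km_commute_E n) (coeff_km_commute_F n)
      (coeff_km_commute_kp hh n)
      (fun i m => commute_coeff_mul (fun a => kmU_commute 0 i a m)
        (commute_rescaleSeq (fun a => kmU_commute 1 i a m) _) n))

end
end

section
/- In the algebra U'_h(ĝl₂)_k, every Fourier coefficient of each of the two power series l^±_{11}(zq²)·( l^±_{22}(z) − l^±_{21}(z)·l^±_{11}(z)^{−1}·l^±_{12}(z) ) − 1 is a central element of U'_h(ĝl₂)_k, where l^±_{11}(z)^{−1} denotes the multiplicative inverse power series (well defined since the constant terms l^±_{11}[0] are invertible). -/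
/-!
The quantum affine algebra `U'_h(ĝl₂)_k` in the Reshetikhin–Semenov-Tian-Shansky (RS)
realization, presented by generators and coefficientwise RLL relations.

Conventions: `q = e^h` (with `Re h < 0`, so `0 < |q| < 1`), `q^k = e^{hk}`.  The index
`i : Fin 2` with `i = 0` stands for the subscript `1` and `i = 1` for the subscript `2`.
The series are `l^+_{ij}(z) = Σ_{n≥0} l^+_{ij}[−n]zⁿ`, `l^−_{ij}(z) = Σ_{n≥0} l^−_{ij}[n]z⁻ⁿ`,
with `l^+_{12}[0] = l^−_{21}[0] = 0`, and each relation is understood coefficientwise.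
-/

noncomputable section

open Finset

/-- Generators of `U'_h(ĝl₂)_k` (RS realization): the modes `l^+_{ij}[−n]` and
`l^−_{ij}[n]`, `i,j ∈ {1,2}` (here `0,1`), `n ≥ 0`.  The modes `l^+_{12}[0]` and
`l^−_{21}[0]` are set to zero by a relation below. -/
inductive RSGen : Type
  | p : Fin 2 → Fin 2 → ℕ → RSGen
  | m : Fin 2 → Fin 2 → ℕ → RSGen

/-- The free algebra on the RS generators. -/
abbrev RSFA : Type := FreeAlgebra ℂ RSGen

/-- The coefficient of `zⁿ` in `l^+_{ij}(z)` (zero for `n < 0`). -/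
def lpG (i j : Fin 2) (n : ℤ) : RSFA :=
  if 0 ≤ n then FreeAlgebra.ι ℂ (RSGen.p i j n.toNat) else 0

/-- The coefficient of `z⁻ⁿ` in `l^−_{ij}(z)` (zero for `n < 0`). -/
def lmG (i j : Fin 2) (n : ℤ) : RSFA :=
  if 0 ≤ n then FreeAlgebra.ι ℂ (RSGen.m i j n.toNat) else 0

/-- The entry of the R-matrix `R(x)` (rows and columns indexed by
`(1,1),(1,2),(2,1),(2,2)`), as a function of `x`, with `q = e^h`:
`R(x) = f(x)·[[1,0,0,0],[0,(1−x)/(q−xq⁻¹),x(q−q⁻¹)/(q−xq⁻¹),0],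
[0,(q−q⁻¹)/(q−xq⁻¹),(1−x)/(q−xq⁻¹),0],[0,0,0,1]]`. -/
def REnt (h : ℂ) (a b : Fin 2 × Fin 2) (x : ℂ) : ℂ :=
  fProd (Complex.exp h) x *
    (if a = b then
      (if a.1 = a.2 then 1 else (1 - x) / (Complex.exp h - x * Complex.exp (-h)))
    else if a = ((0 : Fin 2), (1 : Fin 2)) ∧ b = ((1 : Fin 2), (0 : Fin 2)) then
      x * (Complex.exp h - Complex.exp (-h)) / (Complex.exp h - x * Complex.exp (-h))
    else if a = ((1 : Fin 2), (0 : Fin 2)) ∧ b = ((0 : Fin 2), (1 : Fin 2)) then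
      (Complex.exp h - Complex.exp (-h)) / (Complex.exp h - x * Complex.exp (-h))
    else 0)

/-- The `m`-th Taylor coefficient at `0` of the entry `R(x)_{ab}`: the coefficientwise
power series expansion of the R-matrix in `x = z/w`. -/
def RC (h : ℂ) (a b : Fin 2 × Fin 2) (m : ℕ) : ℂ :=
  iteratedDeriv m (REnt h a b) 0 / (m.factorial : ℂ)

/-- The defining relations of `U'_h(ĝl₂)_k`: the vanishing of `l^+_{12}[0]`, `l^−_{21}[0]`,
invertibility of the constant diagonal modes, and the RLL relations
`R(z/w)L₁^±(z)L₂^±(w) = L₂^±(w)L₁^±(z)R(z/w)` and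
`R((z/w)q^{−k})L₁^+(z)L₂^−(w) = L₂^−(w)L₁^+(z)R((z/w)q^{k})`, written coefficientwise
(the coefficient of each monomial in `z, w`). -/
inductive RSRel (h k : ℂ) : RSFA → RSFA → Prop
  | p120 : RSRel h k (lpG 0 1 0) 0
  | m210 : RSRel h k (lmG 1 0 0) 0
  | diagPM (i : Fin 2) : RSRel h k (lpG i i 0 * lmG i i 0) 1
  | diagMP (i : Fin 2) : RSRel h k (lmG i i 0 * lpG i i 0) 1
  /- `R(z/w)L₁^+(z)L₂^+(w) = L₂^+(w)L₁^+(z)R(z/w)`, coefficient of `z^α w^β`. -/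
  | RLLpp (i a j b : Fin 2) (α β : ℤ) : RSRel h k
      (∑ kk : Fin 2, ∑ c : Fin 2, ∑ m ∈ Finset.range (α.toNat + 1),
        RC h (i, a) (kk, c) m • (lpG kk j (α - m) * lpG c b (β + m)))
      (∑ kk : Fin 2, ∑ c : Fin 2, ∑ m ∈ Finset.range (α.toNat + 1),
        RC h (kk, c) (j, b) m • (lpG a c (β + m) * lpG i kk (α - m)))
  /- `R(z/w)L₁^−(z)L₂^−(w) = L₂^−(w)L₁^−(z)R(z/w)`, coefficient of `z^{−α} w^{−β}`. -/
  | RLLmm (i a j b : Fin 2) (α β : ℤ) : RSRel h k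
      (∑ kk : Fin 2, ∑ c : Fin 2, ∑ m ∈ Finset.range (β.toNat + 1),
        RC h (i, a) (kk, c) m • (lmG kk j (α + m) * lmG c b (β - m)))
      (∑ kk : Fin 2, ∑ c : Fin 2, ∑ m ∈ Finset.range (β.toNat + 1),
        RC h (kk, c) (j, b) m • (lmG a c (β - m) * lmG i kk (α + m)))
  /- `R((z/w)q^{−k})L₁^+(z)L₂^−(w) = L₂^−(w)L₁^+(z)R((z/w)q^{k})`,
     coefficient of `z^α w^{−β}`. -/
  | RLLpm (i a j b : Fin 2) (α β : ℤ) : RSRel h k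
      (∑ kk : Fin 2, ∑ c : Fin 2, ∑ m ∈ Finset.range ((min α β).toNat + 1),
        (Complex.exp (-(h * k) * (m : ℂ)) * RC h (i, a) (kk, c) m) •
          (lpG kk j (α - m) * lmG c b (β - m)))
      (∑ kk : Fin 2, ∑ c : Fin 2, ∑ m ∈ Finset.range ((min α β).toNat + 1),
        (Complex.exp ((h * k) * (m : ℂ)) * RC h (kk, c) (j, b) m) •
          (lmG a c (β - m) * lpG i kk (α - m)))

/-- `U'_h(ĝl₂)_k`: the quotient of the free algebra by the defining relations. -/
abbrev Uhgl2RS (h k : ℂ) := RingQuot (RSRel h k)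

/-- The canonical projection `RSFA → U'_h(ĝl₂)_k`. -/
def rsMk (h k : ℂ) : RSFA →ₐ[ℂ] Uhgl2RS h k := RingQuot.mkAlgHom ℂ (RSRel h k)

/-- Coefficients of `l^+_{11}(z)⁻¹` (formal inverse, with `l^+_{11}[0]⁻¹ = l^−_{11}[0]`). -/
def invLp11 : ℕ → RSFA := seriesInv (fun n => lpG 0 0 (n : ℤ)) (lmG 0 0 0)

/-- Coefficients of `l^−_{11}(z)⁻¹` (formal inverse, with `l^−_{11}[0]⁻¹ = l^+_{11}[0]`). -/
def invLm11 : ℕ → RSFA := seriesInv (fun n => lmG 0 0 (n : ℤ)) (lpG 0 0 0)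

/-- The coefficient of `zⁿ` in `l^+_{22}(z) − l^+_{21}(z)·l^+_{11}(z)⁻¹·l^+_{12}(z)`. -/
def kk2p (n : ℕ) : RSFA :=
  lpG 1 1 (n : ℤ) - ∑ a ∈ Finset.range (n + 1), ∑ b ∈ Finset.range (n + 1 - a),
    lpG 1 0 (a : ℤ) * invLp11 b * lpG 0 1 ((n : ℤ) - a - b)

/-- The coefficient of `z⁻ⁿ` in `l^−_{22}(z) − l^−_{21}(z)·l^−_{11}(z)⁻¹·l^−_{12}(z)`. -/
def kk2m (n : ℕ) : RSFA :=
  lmG 1 1 (n : ℤ) - ∑ a ∈ Finset.range (n + 1), ∑ b ∈ Finset.range (n + 1 - a),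
    lmG 1 0 (a : ℤ) * invLm11 b * lmG 0 1 ((n : ℤ) - a - b)

/-- The coefficient of `zⁿ` in
`l^+_{11}(zq²)·(l^+_{22}(z) − l^+_{21}(z)l^+_{11}(z)⁻¹l^+_{12}(z)) − 1`. -/
def Dp (h : ℂ) (n : ℕ) : RSFA :=
  (∑ j ∈ Finset.range (n + 1),
      Complex.exp (2 * h * (j : ℂ)) • (lpG 0 0 (j : ℤ) * kk2p (n - j)))
    - (if n = 0 then 1 else 0)

/-- The coefficient of `z⁻ⁿ` in
`l^−_{11}(zq²)·(l^−_{22}(z) − l^−_{21}(z)l^−_{11}(z)⁻¹l^−_{12}(z)) − 1`. -/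
def Dm (h : ℂ) (n : ℕ) : RSFA :=
  (∑ j ∈ Finset.range (n + 1),
      Complex.exp (-2 * h * (j : ℂ)) • (lmG 0 0 (j : ℤ) * kk2m (n - j)))
    - (if n = 0 then 1 else 0)

/-! ### Taylor series at the origin -/

/-- The Taylor series of `g` at `0`. -/
def taylorSer (g : ℂ → ℂ) : PowerSeries ℂ :=
  PowerSeries.mk fun n => iteratedDeriv n g 0 / (n.factorial : ℂ)

theorem taylorSer_congr {f g : ℂ → ℂ} (hfg : f =ᶠ[nhds 0] g) : taylorSer f = taylorSer g := by
  ext n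
  simp [taylorSer, (hfg.iteratedDeriv n).eq_of_nhds]

theorem constantCoeff_taylorSer (g : ℂ → ℂ) : PowerSeries.constantCoeff (taylorSer g) = g 0 := by
  simp [taylorSer]

theorem taylorSer_mul {f g : ℂ → ℂ} (hf : AnalyticAt ℂ f 0) (hg : AnalyticAt ℂ g 0) :
    taylorSer (fun x => f x * g x) = taylorSer f * taylorSer g := by
  ext n
  have := iteratedDeriv_fun_mul (n := n) hf.contDiffAt hg.contDiffAt
  rw [PowerSeries.coeff_mul, Finset.Nat.sum_antidiagonal_eq_sum_range_succ_mk]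
  simp only [taylorSer, PowerSeries.coeff_mk, this, Finset.sum_div]
  refine Finset.sum_congr rfl fun i hi => ?_
  have hi' : i ≤ n := Nat.lt_succ_iff.mp (Finset.mem_range.mp hi)
  rw [Nat.cast_choose ℂ hi']
  have h1 : (n.factorial : ℂ) ≠ 0 := by exact_mod_cast n.factorial_ne_zero
  have h2 : (i.factorial : ℂ) ≠ 0 := by exact_mod_cast i.factorial_ne_zero
  have h3 : ((n - i).factorial : ℂ) ≠ 0 := by exact_mod_cast (n - i).factorial_ne_zero
  field_simp

theorem taylorSer_affine (a b : ℂ) :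
    taylorSer (fun x => a + b * x) = PowerSeries.C a + PowerSeries.C b * PowerSeries.X := by
  ext n
  rcases n with _ | _ | n
  · simp [taylorSer]
  · simp [taylorSer, PowerSeries.coeff_C]
  · simp [taylorSer, iteratedDeriv_succ', PowerSeries.coeff_succ_mul_X]

theorem taylorSer_zero : taylorSer (fun _ => 0) = 0 := by
  simpa using taylorSer_affine 0 0

theorem taylorSer_comp_mul {f : ℂ → ℂ} (hf : Differentiable ℂ f) (c : ℂ) :
    taylorSer (fun x => f (c * x)) = PowerSeries.rescale c (taylorSer f) := by
  ext n
  simp [taylorSer, iteratedDeriv_comp_const_mul (hf.contDiff (n := n)) c, mul_div_assoc]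

/-! ### The scalar factor of the R-matrix -/

/-- `∏_{n≥0} (1 − x rⁿ)`. -/
def qFactor (r x : ℂ) : ℂ := ∏' n : ℕ, (1 + -(x * r ^ n))

theorem summable_mul_geometric {r : ℂ} (hr : ‖r‖ < 1) (x : ℂ) :
    Summable fun n : ℕ => ‖-(x * r ^ n)‖ := by
  simpa using (summable_geometric_of_lt_one (norm_nonneg _) hr).mul_left ‖x‖

theorem multipliable_qFactor {r : ℂ} (hr : ‖r‖ < 1) (x : ℂ) :
    Multipliable fun n : ℕ => 1 + -(x * r ^ n) :=
  multipliable_one_add_of_summable (summable_mul_geometric hr x)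

theorem qFactor_eq {r : ℂ} (hr : ‖r‖ < 1) (x : ℂ) :
    qFactor r x = (1 - x) * qFactor r (r * x) := by
  have hs : (fun n : ℕ => 1 + -(x * r ^ (n + 1))) = fun n : ℕ => 1 + -(r * x * r ^ n) := by
    funext n
    ring
  have h1 : Multipliable fun n : ℕ => 1 + -(x * r ^ (n + 1)) :=
    hs ▸ multipliable_qFactor hr (r * x)
  have h2 := tprod_eq_zero_mul' (f := fun n : ℕ => 1 + -(x * r ^ n)) h1
  unfold qFactor
  rw [h2, hs, pow_zero, mul_one, sub_eq_add_neg]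

theorem qFactor_zero (r : ℂ) : qFactor r 0 = 1 := by simp [qFactor]

theorem differentiable_qFactor {r : ℂ} (hr : ‖r‖ < 1) : Differentiable ℂ (qFactor r) := by
  intro x
  have hb : HasProdLocallyUniformlyOn (fun (n : ℕ) x => 1 + -(x * r ^ n)) (qFactor r)
      (Metric.ball (0 : ℂ) (‖x‖ + 1)) := by
    refine Summable.hasProdLocallyUniformlyOn_one_add Metric.isOpen_ball
      (u := fun n => (‖x‖ + 1) * ‖r‖ ^ n)
      ((summable_geometric_of_lt_one (norm_nonneg _) hr).mul_left _) (.of_forall fun n y hy => ?_)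
      (fun n => by fun_prop)
    rw [norm_neg, norm_mul, norm_pow]
    have : ‖y‖ ≤ ‖x‖ + 1 := by simpa using (mem_ball_zero_iff.mp hy).le
    gcongr
  have hd : DifferentiableOn ℂ (qFactor r) (Metric.ball (0 : ℂ) (‖x‖ + 1)) :=
    hb.differentiableOn (.of_forall fun _ => by
      simpa [Finset.prod_fn] using DifferentiableOn.finsetProd (fun _ _ => by fun_prop))
      Metric.isOpen_ball
  exact hd.differentiableAt (Metric.isOpen_ball.mem_nhds (by simp))

theorem fProd_mul_qFactor {q : ℂ} (hq : ‖q‖ < 1) :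
    (fun x => fProd q x * (qFactor (q ^ 4) (q ^ 2 * x)) ^ 2) =ᶠ[nhds 0]
      fun x => qFactor (q ^ 4) x * qFactor (q ^ 4) (q ^ 4 * x) := by
  have hr : ‖q ^ 4‖ < 1 := by
    rw [norm_pow]; exact pow_lt_one₀ (norm_nonneg _) hq (by norm_num)
  filter_upwards [Metric.ball_mem_nhds (0 : ℂ) one_pos] with x hx
  have hx1 : ‖x‖ < 1 := by simpa using hx
  have hne : ∀ n : ℕ, 1 + -((q ^ 2 * x) * (q ^ 4) ^ n) ≠ 0 := by
    intro n h0
    have h1 : (q ^ 2 * x) * (q ^ 4) ^ n = 1 := by linear_combination -h0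
    have h2 : ‖(q ^ 2 * x) * (q ^ 4) ^ n‖ < 1 := by
      have e : (q ^ 2 * x) * (q ^ 4) ^ n = q ^ (4 * n + 2) * x := by ring
      rw [e, norm_mul, norm_pow]
      calc ‖q‖ ^ (4 * n + 2) * ‖x‖ ≤ 1 * ‖x‖ := by
            gcongr; exact pow_le_one₀ (norm_nonneg _) hq.le
        _ < 1 := by simpa using hx1
    rw [h1] at h2
    simp at h2
  have hE2 : qFactor (q ^ 4) (q ^ 2 * x) ≠ 0 :=
    tprod_one_add_ne_zero_of_summable hne (summable_mul_geometric hr _)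
  have m0 := (multipliable_qFactor hr x).hasProd
  have m4 := (multipliable_qFactor hr (q ^ 4 * x)).hasProd
  have m2 := (multipliable_qFactor hr (q ^ 2 * x)).hasProd
  have key : fProd q x = qFactor (q ^ 4) x * qFactor (q ^ 4) (q ^ 4 * x) /
      (qFactor (q ^ 4) (q ^ 2 * x) * qFactor (q ^ 4) (q ^ 2 * x)) := by
    refine HasProd.tprod_eq ?_
    have := (m0.mul m4).div₀ (m2.mul m2) (mul_ne_zero hE2 hE2)
    refine (congrArg (fun g : ℕ → ℂ => HasProd g _) (funext fun n => ?_)).mp this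
    ring
  simp only [key]
  field_simp

/-- The scalar factor `f` of the R-matrix, as a power series. -/
def fSer (h : ℂ) : PowerSeries ℂ := taylorSer (fProd (Complex.exp h))

theorem norm_exp_lt_one {h : ℂ} (hh : h.re < 0) : ‖Complex.exp h‖ < 1 := by
  rw [Complex.norm_exp]
  simpa using hh

theorem analyticAt_fProd {q : ℂ} (hq : ‖q‖ < 1) : AnalyticAt ℂ (fProd q) 0 := by
  have hr : ‖q ^ 4‖ < 1 := by
    rw [norm_pow]; exact pow_lt_one₀ (norm_nonneg _) hq (by norm_num)
  have hd := differentiable_qFactor hr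
  have han : ∀ c : ℂ, AnalyticAt ℂ (fun x => qFactor (q ^ 4) (c * x)) 0 := fun c =>
    (hd.comp (differentiable_id.const_mul c)).analyticAt 0
  have h2 : qFactor (q ^ 4) (q ^ 2 * 0) ^ 2 ≠ 0 := by simp [qFactor_zero]
  refine AnalyticAt.congr ((((hd.analyticAt 0).mul (han (q ^ 4)))).div ((han (q ^ 2)).pow 2) h2) ?_
  have hne := ((han (q ^ 2)).pow 2).continuousAt.eventually_ne h2
  filter_upwards [fProd_mul_qFactor hq, hne] with x hx hx2
  exact (eq_div_of_mul_eq hx2 hx).symm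

theorem constantCoeff_fSer (h : ℂ) : PowerSeries.constantCoeff (fSer h) = 1 := by
  simp [fSer, constantCoeff_taylorSer, fProd]

theorem fSer_mul_rescale {h : ℂ} (hh : h.re < 0) :
    fSer h * PowerSeries.rescale (Complex.exp h ^ 2) (fSer h) *
      (1 - PowerSeries.C (Complex.exp h ^ 2) * PowerSeries.X) = 1 - PowerSeries.X := by
  have hq := norm_exp_lt_one hh
  set q := Complex.exp h with hqd
  have hr : ‖q ^ 4‖ < 1 := by
    rw [norm_pow]; exact pow_lt_one₀ (norm_nonneg _) hq (by norm_num)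
  have hd := differentiable_qFactor hr
  have han : ∀ c : ℂ, AnalyticAt ℂ (fun x => qFactor (q ^ 4) (c * x)) 0 := fun c =>
    (hd.comp (differentiable_id.const_mul c)).analyticAt 0
  set E := taylorSer (qFactor (q ^ 4)) with hE
  have hE0 : PowerSeries.constantCoeff E = 1 := by
    rw [hE, constantCoeff_taylorSer, qFactor_zero]
  have hres : ∀ c : ℂ, PowerSeries.rescale c E ≠ 0 := fun c h0 => by
    have := congrArg PowerSeries.constantCoeff h0
    rw [← PowerSeries.coeff_zero_eq_constantCoeff_apply, PowerSeries.coeff_rescale] at this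
    simp [hE0] at this
  have e1 : fSer h * PowerSeries.rescale (q ^ 2) E ^ 2 = E * PowerSeries.rescale (q ^ 4) E := by
    have h1 := taylorSer_congr (fProd_mul_qFactor hq)
    simp only [pow_two (qFactor _ _)] at h1
    rw [taylorSer_mul (hd.analyticAt 0) (han _),
      taylorSer_mul (f := fProd q) (analyticAt_fProd hq) ((han _).fun_mul (han _)),
      taylorSer_mul (han _) (han _), taylorSer_comp_mul hd, taylorSer_comp_mul hd] at h1
    rw [pow_two]
    exact h1
  have e2 : E = (1 - PowerSeries.X) * PowerSeries.rescale (q ^ 4) E := by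
    have h1 : taylorSer (qFactor (q ^ 4)) =
        taylorSer (fun x => (1 + (-1) * x) * qFactor (q ^ 4) (q ^ 4 * x)) := by
      congr 1
      funext x
      rw [qFactor_eq hr x]
      ring
    rw [taylorSer_mul (by fun_prop) (han _), taylorSer_comp_mul hd, taylorSer_affine] at h1
    simpa [sub_eq_add_neg] using h1
  have e3 := congrArg (PowerSeries.rescale (q ^ 2)) e1
  have e4 := congrArg (PowerSeries.rescale (q ^ 2)) e2
  simp only [map_mul, map_pow, PowerSeries.rescale_rescale, map_sub, map_one,
    PowerSeries.rescale_X] at e3 e4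
  have p1 : q ^ 2 * q ^ 2 = q ^ 4 := by ring
  have p2 : q ^ 4 * q ^ 2 = q ^ 6 := by ring
  rw [p1, p2] at e3
  rw [p2] at e4
  set E2 := PowerSeries.rescale (q ^ 2) E
  set E4 := PowerSeries.rescale (q ^ 4) E
  set E6 := PowerSeries.rescale (q ^ 6) E
  set F := fSer h
  set F2 := PowerSeries.rescale (q ^ 2) F
  have hne : E2 ^ 3 * E4 ^ 2 ≠ 0 := mul_ne_zero (pow_ne_zero _ (hres _)) (pow_ne_zero _ (hres _))
  refine mul_right_cancel₀ hne ?_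
  rw [map_pow]
  linear_combination (F2 * (1 - PowerSeries.C q ^ 2 * PowerSeries.X) * E2 * E4 ^ 2) * e1 +
    ((1 - PowerSeries.C q ^ 2 * PowerSeries.X) * E2 * E4 * E) * e3 - (E2 ^ 2 * E4 * E) * e4 +
    (E2 ^ 3 * E4) * e2

/-! ### RLL relations and the quantum determinant -/

section RLL

variable {K S : Type*} [CommRing K] [Ring S] [Algebra K S]

/-- The covector `e₁ ⊗ e₂ − q e₂ ⊗ e₁`. -/
def qAnti (q : K) (a b : Fin 2) : K :=
  if a = 0 ∧ b = 1 then 1 else if a = 1 ∧ b = 0 then -q else 0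

/-- The relation `R M₁ N₂ = N₂ M₁ Q`. -/
def RLL (R Q : Fin 2 × Fin 2 → Fin 2 × Fin 2 → K) (M N : Fin 2 → Fin 2 → S) : Prop :=
  ∀ i a j b : Fin 2, ∑ p : Fin 2, ∑ c : Fin 2, R (i, a) (p, c) • (M p j * N c b) =
    ∑ p : Fin 2, ∑ c : Fin 2, Q (p, c) (j, b) • (N a c * M i p)

/-- `D` is the quantum determinant of the pair `(N', N)`: the `q`-antisymmetric covector is
mapped to its multiple by `D` under `N'₁ N₂`. -/
def IsQDet (q : K) (N' N : Fin 2 → Fin 2 → S) (D : S) : Prop :=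
  ∀ j b : Fin 2, ∑ a : Fin 2, ∑ c : Fin 2, qAnti q a c • (N' a j * N c b) = qAnti q j b • D

/-- `R₁ = R(xq²)` and `R₂ = R(x)` act on the `q`-antisymmetric covector by the scalar `s`. -/
structure QFusion (q s : K) (R₁ R₂ : Fin 2 × Fin 2 → Fin 2 × Fin 2 → K) : Prop where
  right : ∀ i j c d : Fin 2, ∑ a : Fin 2, ∑ b : Fin 2, ∑ p : Fin 2,
    qAnti q a b * R₁ (i, b) (p, d) * R₂ (p, a) (j, c) = if i = j then s * qAnti q c d else 0
  left : ∀ i j c d : Fin 2, ∑ a : Fin 2, ∑ b : Fin 2, ∑ p : Fin 2,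
    qAnti q a b * R₁ (a, i) (c, p) * R₂ (b, p) (d, j) = if i = j then s * qAnti q c d else 0

theorem RLL.commute_right {R₁ R₂ Q₁ Q₂ : Fin 2 × Fin 2 → Fin 2 × Fin 2 → K}
    {M N' N : Fin 2 → Fin 2 → S} {D : S} {q s : K} (h₁ : RLL R₁ Q₁ M N) (h₂ : RLL R₂ Q₂ M N')
    (hD : IsQDet q N' N D) (hR : QFusion q s R₁ R₂) (hQ : QFusion q s Q₁ Q₂) (hs : IsUnit s)
    (i j : Fin 2) : M i j * D = D * M i j := by
  have e₁ : ∑ k : Fin 2, ∑ c : Fin 2, ∑ e : Fin 2, (∑ a : Fin 2, ∑ b : Fin 2, ∑ p : Fin 2,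
        qAnti q a b * R₁ (i, b) (p, e) * R₂ (p, a) (k, c)) • (M k j * (N' c 0 * N e 1)) =
      ∑ a : Fin 2, ∑ b : Fin 2, ∑ p : Fin 2, ∑ e : Fin 2, (qAnti q a b * R₁ (i, b) (p, e)) •
        ((∑ k : Fin 2, ∑ c : Fin 2, R₂ (p, a) (k, c) • (M k j * N' c 0)) * N e 1) := by
    simp only [Fin.sum_univ_two, add_mul, smul_mul_assoc, mul_assoc]
    module
  have e₂ : ∑ a : Fin 2, ∑ b : Fin 2, ∑ p : Fin 2, ∑ e : Fin 2, (qAnti q a b * R₁ (i, b) (p, e)) •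
        ((∑ k : Fin 2, ∑ c : Fin 2, Q₂ (k, c) (j, 0) • (N' a c * M p k)) * N e 1) =
      ∑ a : Fin 2, ∑ b : Fin 2, ∑ k : Fin 2, ∑ c : Fin 2, (qAnti q a b * Q₂ (k, c) (j, 0)) •
        (N' a c * ∑ p : Fin 2, ∑ e : Fin 2, R₁ (i, b) (p, e) • (M p k * N e 1)) := by
    simp only [Fin.sum_univ_two, add_mul, mul_add, smul_mul_assoc, mul_smul_comm, mul_assoc]
    module
  have e₃ : ∑ a : Fin 2, ∑ b : Fin 2, ∑ k : Fin 2, ∑ c : Fin 2, (qAnti q a b * Q₂ (k, c) (j, 0)) •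
        (N' a c * ∑ p : Fin 2, ∑ e : Fin 2, Q₁ (p, e) (k, 1) • (N b e * M i p)) =
      ∑ p : Fin 2, ∑ k : Fin 2, ∑ c : Fin 2, ∑ e : Fin 2,
        (Q₂ (k, c) (j, 0) * Q₁ (p, e) (k, 1)) •
        ((∑ a : Fin 2, ∑ b : Fin 2, qAnti q a b • (N' a c * N b e)) * M i p) := by
    simp only [Fin.sum_univ_two, add_mul, mul_add, smul_mul_assoc, mul_smul_comm, mul_assoc]
    module
  have e₄ : ∑ p : Fin 2, ∑ k : Fin 2, ∑ c : Fin 2, ∑ e : Fin 2,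
        (Q₂ (k, c) (j, 0) * Q₁ (p, e) (k, 1)) • (qAnti q c e • D * M i p) =
      ∑ p : Fin 2, (∑ c : Fin 2, ∑ e : Fin 2, ∑ k : Fin 2,
        qAnti q c e * Q₁ (p, e) (k, 1) * Q₂ (k, c) (j, 0)) • (D * M i p) := by
    simp only [Fin.sum_univ_two, smul_mul_assoc]
    module
  have e₅ : ∑ k : Fin 2, ∑ c : Fin 2, ∑ e : Fin 2,
        (if i = k then s * qAnti q c e else 0) • (M k j * (N' c 0 * N e 1)) =
      s • (M i j * ∑ c : Fin 2, ∑ e : Fin 2, qAnti q c e • (N' c 0 * N e 1)) := by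
    simp only [ite_smul, zero_smul, Finset.mul_sum, Finset.smul_sum, mul_smul_comm, smul_smul]
    rw [Finset.sum_eq_single i (fun k _ hk => by simp [Ne.symm hk]) (by simp)]
    simp
  simp_rw [hR.right, e₅, h₂ _ _ _ _, e₂, h₁ _ _ _ _, e₃, hD _ _, e₄, hQ.right] at e₁
  have e₆ : s • (M i j * D) = s • (D * M i j) := by
    simpa [qAnti, ite_smul, Finset.sum_ite_eq'] using e₁
  exact hs.smul_left_cancel.mp e₆

theorem RLL.commute_left {R₁ R₂ Q₁ Q₂ : Fin 2 × Fin 2 → Fin 2 × Fin 2 → K}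
    {M' M N : Fin 2 → Fin 2 → S} {D : S} {q s : K} (h₁ : RLL R₁ Q₁ M' N) (h₂ : RLL R₂ Q₂ M N)
    (hD : IsQDet q M' M D) (hR : QFusion q s R₁ R₂) (hQ : QFusion q s Q₁ Q₂) (hs : IsUnit s)
    (i j : Fin 2) : D * N i j = N i j * D := by
  have e₁ : ∑ k : Fin 2, ∑ c : Fin 2, ∑ d : Fin 2, (∑ a : Fin 2, ∑ b : Fin 2, ∑ p : Fin 2,
        qAnti q a b * R₁ (a, i) (c, p) * R₂ (b, p) (d, k)) • ((M' c 0 * M d 1) * N k j) =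
      ∑ a : Fin 2, ∑ b : Fin 2, ∑ p : Fin 2, ∑ c : Fin 2, (qAnti q a b * R₁ (a, i) (c, p)) •
        (M' c 0 * ∑ d : Fin 2, ∑ k : Fin 2, R₂ (b, p) (d, k) • (M d 1 * N k j)) := by
    simp only [Fin.sum_univ_two, mul_add, mul_smul_comm, mul_assoc]
    module
  have e₂ : ∑ a : Fin 2, ∑ b : Fin 2, ∑ p : Fin 2, ∑ c : Fin 2, (qAnti q a b * R₁ (a, i) (c, p)) •
        (M' c 0 * ∑ d : Fin 2, ∑ k : Fin 2, Q₂ (d, k) (1, j) • (N p k * M b d)) =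
      ∑ a : Fin 2, ∑ b : Fin 2, ∑ d : Fin 2, ∑ k : Fin 2, (qAnti q a b * Q₂ (d, k) (1, j)) •
        ((∑ c : Fin 2, ∑ p : Fin 2, R₁ (a, i) (c, p) • (M' c 0 * N p k)) * M b d) := by
    simp only [Fin.sum_univ_two, add_mul, mul_add, smul_mul_assoc, mul_smul_comm, mul_assoc]
    module
  have e₃ : ∑ a : Fin 2, ∑ b : Fin 2, ∑ d : Fin 2, ∑ k : Fin 2, (qAnti q a b * Q₂ (d, k) (1, j)) •
        ((∑ c : Fin 2, ∑ p : Fin 2, Q₁ (c, p) (0, k) • (N i p * M' a c)) * M b d) =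
      ∑ p : Fin 2, ∑ c : Fin 2, ∑ d : Fin 2, ∑ k : Fin 2,
        (Q₁ (c, p) (0, k) * Q₂ (d, k) (1, j)) •
        (N i p * ∑ a : Fin 2, ∑ b : Fin 2, qAnti q a b • (M' a c * M b d)) := by
    simp only [Fin.sum_univ_two, add_mul, mul_add, smul_mul_assoc, mul_smul_comm, mul_assoc]
    module
  have e₄ : ∑ p : Fin 2, ∑ c : Fin 2, ∑ d : Fin 2, ∑ k : Fin 2,
        (Q₁ (c, p) (0, k) * Q₂ (d, k) (1, j)) • (N i p * qAnti q c d • D) =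
      ∑ p : Fin 2, (∑ c : Fin 2, ∑ d : Fin 2, ∑ k : Fin 2,
        qAnti q c d * Q₁ (c, p) (0, k) * Q₂ (d, k) (1, j)) • (N i p * D) := by
    simp only [Fin.sum_univ_two, mul_smul_comm]
    module
  have e₅ : ∑ k : Fin 2, ∑ c : Fin 2, ∑ d : Fin 2,
        (if i = k then s * qAnti q c d else 0) • ((M' c 0 * M d 1) * N k j) =
      s • ((∑ c : Fin 2, ∑ d : Fin 2, qAnti q c d • (M' c 0 * M d 1)) * N i j) := by
    simp only [ite_smul, zero_smul, Finset.sum_mul, Finset.smul_sum, smul_mul_assoc, smul_smul]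
    rw [Finset.sum_eq_single i (fun k _ hk => by simp [Ne.symm hk]) (by simp)]
    simp
  simp_rw [hR.left, e₅, h₂ _ _ _ _, e₂, h₁ _ _ _ _, e₃, hD _ _, e₄, hQ.left] at e₁
  have e₆ : s • (D * N i j) = s • (N i j * D) := by
    simpa [qAnti, ite_smul, Finset.sum_ite_eq'] using e₁
  exact hs.smul_left_cancel.mp e₆

/-- A matrix of six-vertex type. -/
def sixVertex (a b c d : K) (u v : Fin 2 × Fin 2) : K :=
  if u = v then (if u.1 = u.2 then a else b)
  else if u = (0, 1) ∧ v = (1, 0) then c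
  else if u = (1, 0) ∧ v = (0, 1) then d
  else 0

theorem qFusion_sixVertex {a b c d a' b' c' d' q s : K} (h₁ : b * a' = s)
    (h₂ : a * b' - q * d * c' = s) (h₃ : c * d' - q * a * b' = -(q * s))
    (h₄ : c * b' = q * a * c') (h₅ : a * d' = q * d * b') :
    QFusion q s (sixVertex a b c d) (sixVertex a' b' c' d') := by
  constructor <;> intro i j k l <;>
    fin_cases i <;> fin_cases j <;> fin_cases k <;> fin_cases l <;>
    simp [qAnti, sixVertex] <;> grind

theorem QFusion.map {K' : Type*} [CommRing K'] (φ : K →+* K') {q s : K}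
    {R₁ R₂ : Fin 2 × Fin 2 → Fin 2 × Fin 2 → K} (h : QFusion q s R₁ R₂) :
    QFusion (φ q) (φ s) (fun u v => φ (R₁ u v)) (fun u v => φ (R₂ u v)) := by
  have hq : ∀ a b, qAnti (φ q) a b = φ (qAnti q a b) := fun a b => by
    unfold qAnti; split_ifs <;> simp
  constructor
  · intro i j c d
    simpa [hq, apply_ite φ] using congrArg φ (h.right i j c d)
  · intro i j c d
    simpa [hq, apply_ite φ] using congrArg φ (h.left i j c d)

end RLL

/-! ### The R-matrix as a matrix of power series -/

/-- The power series expansion of the entries of `R(x)`. -/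
def RSer (h : ℂ) (u v : Fin 2 × Fin 2) : PowerSeries ℂ := PowerSeries.mk (RC h u v)

/-- The power series expansion of `1/(q − xq⁻¹)`. -/
def gSer (h : ℂ) : PowerSeries ℂ :=
  taylorSer fun x => (Complex.exp h + -(Complex.exp h)⁻¹ * x)⁻¹

theorem analyticAt_denom (h : ℂ) :
    AnalyticAt ℂ (fun x => (Complex.exp h + -(Complex.exp h)⁻¹ * x)⁻¹) 0 :=
  AnalyticAt.fun_inv (by fun_prop) (by simp)

theorem mul_gSer (h : ℂ) :
    (PowerSeries.C (Complex.exp h) - PowerSeries.C (Complex.exp h)⁻¹ * PowerSeries.X) * gSer h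
      = 1 := by
  have h1 : taylorSer (fun x => (Complex.exp h + -(Complex.exp h)⁻¹ * x) *
      (Complex.exp h + -(Complex.exp h)⁻¹ * x)⁻¹) = taylorSer fun x => 1 + 0 * x := by
    refine taylorSer_congr ?_
    have hc : ContinuousAt (fun x => Complex.exp h + -(Complex.exp h)⁻¹ * x) 0 := by fun_prop
    filter_upwards [hc.eventually_ne (y := 0) (by simp)] with x hx
    exact (mul_inv_cancel₀ hx).trans (by simp)
  rw [taylorSer_mul (by fun_prop) (analyticAt_denom h), taylorSer_affine, taylorSer_affine] at h1
  change _ * gSer h = _ at h1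
  simpa [sub_eq_add_neg] using h1

theorem RSer_eq {h : ℂ} (hh : h.re < 0) :
    RSer h = sixVertex (fSer h) (fSer h * (1 - PowerSeries.X) * gSer h)
      (fSer h * (PowerSeries.C (Complex.exp h) - PowerSeries.C (Complex.exp h)⁻¹) *
        PowerSeries.X * gSer h)
      (fSer h * (PowerSeries.C (Complex.exp h) - PowerSeries.C (Complex.exp h)⁻¹) * gSer h) := by
  have hf := analyticAt_fProd (norm_exp_lt_one hh)
  have hg := analyticAt_denom h
  have key : ∀ a b : ℂ, taylorSer (fun x => fProd (Complex.exp h) x * ((a + b * x) *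
      (Complex.exp h + -(Complex.exp h)⁻¹ * x)⁻¹)) =
      fSer h * ((PowerSeries.C a + PowerSeries.C b * PowerSeries.X) * gSer h) := fun a b => by
    rw [taylorSer_mul hf (AnalyticAt.fun_mul (by fun_prop) hg), taylorSer_mul (by fun_prop) hg,
      taylorSer_affine]
    rfl
  have hR : ∀ u v, RSer h u v = taylorSer (REnt h u v) := fun _ _ => rfl
  have hden : ∀ x : ℂ, Complex.exp h - x * Complex.exp (-h) =
      Complex.exp h + -(Complex.exp h)⁻¹ * x := fun x => by rw [Complex.exp_neg]; ring
  funext u v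
  rw [hR, sixVertex]
  split_ifs with h1 h2 h3 h4
  · rw [show REnt h u v = fProd (Complex.exp h) from funext fun x => by
      rw [REnt, if_pos h1, if_pos h2, mul_one]]
    rfl
  · have := key 1 (-1)
    rw [show REnt h u v = _ from funext fun x => by
      rw [REnt, if_pos h1, if_neg h2, hden, show 1 - x = 1 + (-1) * x by ring, div_eq_mul_inv],
      this]
    simp [sub_eq_add_neg, mul_assoc]
  · have := key 0 (Complex.exp h - (Complex.exp h)⁻¹)
    rw [show REnt h u v = _ from funext fun x => by
      rw [REnt, if_neg h1, if_pos h3, hden, Complex.exp_neg,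
        show x * (Complex.exp h - (Complex.exp h)⁻¹) = 0 + (Complex.exp h - (Complex.exp h)⁻¹) * x
        by ring, div_eq_mul_inv], this]
    simp [mul_assoc]
  · have := key (Complex.exp h - (Complex.exp h)⁻¹) 0
    rw [show REnt h u v = _ from funext fun x => by
      rw [REnt, if_neg h1, if_neg h3, if_pos h4, hden, Complex.exp_neg,
        show (Complex.exp h - (Complex.exp h)⁻¹) = (Complex.exp h - (Complex.exp h)⁻¹) + 0 * x
        by ring, div_eq_mul_inv], this]
    simp [mul_assoc]
  · rw [show REnt h u v = fun _ => 0 from funext fun x => by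
      rw [REnt, if_neg h1, if_neg h3, if_neg h4, mul_zero], taylorSer_zero]

theorem qFusion_RSer {h : ℂ} (hh : h.re < 0) :
    QFusion (PowerSeries.C (Complex.exp h)) (PowerSeries.C (Complex.exp h)⁻¹)
      (fun u v => PowerSeries.rescale (Complex.exp h ^ 2) (RSer h u v)) (RSer h) := by
  have hF := fSer_mul_rescale hh
  have hg := mul_gSer h
  have hg2 := congrArg (PowerSeries.rescale (Complex.exp h ^ 2)) hg
  have hQP : PowerSeries.C (Complex.exp h) * PowerSeries.C (Complex.exp h)⁻¹ = 1 := by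
    rw [← map_mul, mul_inv_cancel₀ (Complex.exp_ne_zero h), map_one]
  have hC : ∀ a b : ℂ, PowerSeries.rescale a (PowerSeries.C b) = PowerSeries.C b := fun a b => by
    ext n
    rcases n with _ | n <;> simp [PowerSeries.coeff_C]
  have hR : (fun u v => PowerSeries.rescale (Complex.exp h ^ 2) (RSer h u v)) =
      sixVertex (PowerSeries.rescale (Complex.exp h ^ 2) (fSer h))
        (PowerSeries.rescale (Complex.exp h ^ 2) (fSer h * (1 - PowerSeries.X) * gSer h))
        (PowerSeries.rescale (Complex.exp h ^ 2) (fSer h *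
          (PowerSeries.C (Complex.exp h) - PowerSeries.C (Complex.exp h)⁻¹) *
          PowerSeries.X * gSer h))
        (PowerSeries.rescale (Complex.exp h ^ 2) (fSer h *
          (PowerSeries.C (Complex.exp h) - PowerSeries.C (Complex.exp h)⁻¹) * gSer h)) := by
    funext u v
    rw [RSer_eq hh]
    unfold sixVertex
    simp only [apply_ite (PowerSeries.rescale (Complex.exp h ^ 2)), map_zero]
  rw [hR, RSer_eq hh]
  simp only [map_mul, map_sub, map_one, map_pow, hC, PowerSeries.rescale_X] at hF hg2 ⊢
  generalize PowerSeries.rescale (Complex.exp h ^ 2) (fSer h) = F2 at *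
  generalize PowerSeries.rescale (Complex.exp h ^ 2) (gSer h) = g2 at *
  generalize PowerSeries.C (Complex.exp h) = Q at *
  generalize PowerSeries.C (Complex.exp h)⁻¹ = P at *
  generalize fSer h = F at *
  generalize gSer h = g at *
  generalize (PowerSeries.X : PowerSeries ℂ) = X at *
  replace hg2 : Q * (1 - X) * g2 = 1 := by linear_combination hg2 + Q * X * g2 * hQP
  have h₂ : F2 * (F * (1 - X) * g) - Q * (F2 * (Q - P) * g2) * (F * (Q - P) * X * g) = P := by
    linear_combination (-(F * F2 * g * (1 - X))) * hg2 +
      (F * F2 * g * Q * g2 * (2 * X - X ^ 2 * (Q * P + 1))) * hQP +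
      (g * Q * g2 * (1 - P ^ 2 * X)) * hF + (g * (1 - P ^ 2 * X)) * hg2 + P * hg - g * hQP
  refine qFusion_sixVertex ?_ h₂ ?_ ?_ ?_
  · linear_combination g2 * hF + P * hg2 - (1 - X) * g2 * hQP
  · linear_combination (-Q) * h₂
  · linear_combination (Q * F2 * F * X * (Q - P) * g) * hg2
  · linear_combination (-(F2 * F * (Q - P) * g)) * hg2

theorem exists_mul_RSer_eq {h : ℂ} (hh : h.re < 0) : ∃ U : PowerSeries ℂ,
    (fun u v => U * RSer h u v) = sixVertex
      (PowerSeries.C (Complex.exp h) - PowerSeries.C (Complex.exp h)⁻¹ * PowerSeries.X)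
      (1 - PowerSeries.X)
      ((PowerSeries.C (Complex.exp h) - PowerSeries.C (Complex.exp h)⁻¹) * PowerSeries.X)
      (PowerSeries.C (Complex.exp h) - PowerSeries.C (Complex.exp h)⁻¹) := by
  have hF : (fSer h)⁻¹ * fSer h = 1 :=
    PowerSeries.inv_mul_cancel _ (by simp [constantCoeff_fSer])
  have hg := mul_gSer h
  refine ⟨(fSer h)⁻¹ *
    (PowerSeries.C (Complex.exp h) - PowerSeries.C (Complex.exp h)⁻¹ * PowerSeries.X), ?_⟩
  funext u v
  rw [RSer_eq hh]
  generalize (fSer h)⁻¹ = F' at *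
  generalize PowerSeries.C (Complex.exp h) = Q at *
  generalize PowerSeries.C (Complex.exp h)⁻¹ = P at *
  generalize fSer h = F at *
  generalize gSer h = g at *
  generalize (PowerSeries.X : PowerSeries ℂ) = X at *
  unfold sixVertex
  split_ifs
  · linear_combination (Q - P * X) * hF
  · linear_combination (F' * F * (1 - X)) * hg + (1 - X) * hF
  · linear_combination (F' * F * (Q - P) * X) * hg + (Q - P) * X * hF
  · linear_combination (F' * F * (Q - P)) * hg + (Q - P) * hF
  · simp

/-! ### RLL relations with power series coefficients -/

section SeriesRLL

variable {S : Type*} [Ring S]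

/-- The relation `R(cx) M₁ N₂ = N₂ M₁ R(c'x)`, where power series in `x` act through `φ`. -/
def SeriesRLL (h : ℂ) (φ : PowerSeries ℂ →+* S) (c c' : ℂ) (M N : Fin 2 → Fin 2 → S) : Prop :=
  ∀ i a j b : Fin 2, ∑ p : Fin 2, ∑ k : Fin 2,
      φ (PowerSeries.rescale c (RSer h (i, a) (p, k))) * (M p j * N k b) =
    ∑ p : Fin 2, ∑ k : Fin 2,
      φ (PowerSeries.rescale c' (RSer h (p, k) (j, b))) * (N a k * M i p)

theorem SeriesRLL.map {φ : PowerSeries ℂ →+* S} {h c c' : ℂ} {M N : Fin 2 → Fin 2 → S}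
    (σ : S →+* S) {d : ℂ}
    (hσ : ∀ r, σ (φ r) = φ (PowerSeries.rescale d r))
    (H : SeriesRLL h φ c c' M N) :
    SeriesRLL h φ (c * d) (c' * d) (fun i j => σ (M i j)) (fun i j => σ (N i j)) := by
  intro i a j b
  simpa [hσ, PowerSeries.rescale_rescale] using congrArg σ (H i a j b)

variable [Algebra ℂ S]

theorem rescale_C (a b : ℂ) : PowerSeries.rescale a (PowerSeries.C b) = PowerSeries.C b := by
  ext n
  rcases n with _ | n <;> simp [PowerSeries.coeff_C]

theorem qFusion_rescale_RSer {h : ℂ} (hh : h.re < 0) (c : ℂ) :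
    QFusion (PowerSeries.C (Complex.exp h)) (PowerSeries.C (Complex.exp h)⁻¹)
      (fun u v => PowerSeries.rescale (Complex.exp h ^ 2 * c) (RSer h u v))
      (fun u v => PowerSeries.rescale c (RSer h u v)) := by
  simpa only [rescale_C, PowerSeries.rescale_rescale] using
    (qFusion_RSer hh).map (PowerSeries.rescale c)

/-- A ring homomorphism from `ℂ⟦X⟧` with central values extending the structure map of a
`ℂ`-algebra. -/
structure IsCentralHom (φ : PowerSeries ℂ →+* S) : Prop where
  central : ∀ r x, φ r * x = x * φ r
  map_C : ∀ c, φ (PowerSeries.C c) = algebraMap ℂ S c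

variable {φ : PowerSeries ℂ →+* S} {h c c' : ℂ} {M M' N N' : Fin 2 → Fin 2 → S} {D : S}

theorem IsCentralHom.qAnti_mul (hφ : IsCentralHom φ) (q : ℂ) (a b : Fin 2) (x : S) :
    φ (qAnti (PowerSeries.C q) a b) * x = qAnti q a b • x := by
  unfold qAnti
  split_ifs
  · simp
  · rw [map_neg, hφ.map_C, neg_mul, neg_smul, Algebra.smul_def]
  · simp

theorem SeriesRLL.commute_right (hφ : IsCentralHom φ) (hh : h.re < 0)
    (h₁ : SeriesRLL h φ (Complex.exp h ^ 2 * c) (Complex.exp h ^ 2 * c') M N)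
    (h₂ : SeriesRLL h φ c c' M N') (hD : IsQDet (Complex.exp h) N' N D) (i j : Fin 2) :
    Commute (M i j) D := by
  let := φ.toAlgebra' hφ.central
  have h₁' : RLL (fun u v => PowerSeries.rescale (Complex.exp h ^ 2 * c) (RSer h u v))
      (fun u v => PowerSeries.rescale (Complex.exp h ^ 2 * c') (RSer h u v)) M N := h₁
  have h₂' : RLL (fun u v => PowerSeries.rescale c (RSer h u v))
      (fun u v => PowerSeries.rescale c' (RSer h u v)) M N' := h₂
  refine h₁'.commute_right h₂' ?_ (qFusion_rescale_RSer hh c) (qFusion_rescale_RSer hh c')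
    ((IsUnit.mk0 _ (inv_ne_zero (Complex.exp_ne_zero h))).map PowerSeries.C) i j
  intro j b
  have := hD j b
  simp only [← hφ.qAnti_mul] at this
  exact this

theorem SeriesRLL.commute_left (hφ : IsCentralHom φ) (hh : h.re < 0)
    (h₁ : SeriesRLL h φ (Complex.exp h ^ 2 * c) (Complex.exp h ^ 2 * c') M' N)
    (h₂ : SeriesRLL h φ c c' M N) (hD : IsQDet (Complex.exp h) M' M D) (i j : Fin 2) :
    Commute D (N i j) := by
  let := φ.toAlgebra' hφ.central
  have h₁' : RLL (fun u v => PowerSeries.rescale (Complex.exp h ^ 2 * c) (RSer h u v))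
      (fun u v => PowerSeries.rescale (Complex.exp h ^ 2 * c') (RSer h u v)) M' N := h₁
  have h₂' : RLL (fun u v => PowerSeries.rescale c (RSer h u v))
      (fun u v => PowerSeries.rescale c' (RSer h u v)) M N := h₂
  refine h₁'.commute_left h₂' ?_ (qFusion_rescale_RSer hh c) (qFusion_rescale_RSer hh c')
    ((IsUnit.mk0 _ (inv_ne_zero (Complex.exp_ne_zero h))).map PowerSeries.C) i j
  intro j b
  have := hD j b
  simp only [← hφ.qAnti_mul] at this
  exact this

theorem IsQDet.map {S' : Type*} [Ring S'] [Algebra ℂ S'] (σ : S →+* S')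
    (hσ : ∀ (c : ℂ) (x : S), σ (c • x) = c • σ x) {q : ℂ} (H : IsQDet q N' N D) :
    IsQDet q (fun i j => σ (N' i j)) (fun i j => σ (N i j)) (σ D) := by
  intro j b
  simpa [hσ] using congrArg σ (H j b)

theorem IsQDet.eq_mul_schur {q : ℂ} (H : IsQDet q N' N D) {v : S} (hv : N 0 0 * v = 1) :
    D = N' 0 0 * (N 1 1 - N 1 0 * v * N 0 1) := by
  have h₁ : N' 0 0 * N 1 1 - q • (N' 1 0 * N 0 1) = D := by
    simpa [IsQDet, qAnti, sub_eq_add_neg] using H 0 1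
  have h₂ : N' 0 0 * N 1 0 - q • (N' 1 0 * N 0 0) = 0 := by
    simpa [IsQDet, qAnti, sub_eq_add_neg] using H 0 0
  have h₃ : N' 0 0 * N 1 0 * v * N 0 1 = q • (N' 1 0 * N 0 1) := by
    rw [sub_eq_zero.mp h₂, smul_mul_assoc, smul_mul_assoc, mul_assoc (N' 1 0), hv, mul_one]
  rw [← h₁, ← h₃, mul_sub]
  simp only [mul_assoc]

end SeriesRLL

/-! ### Series in two variables -/

section TwoVariables

open PowerSeries

variable {A : Type*} [Ring A]

/-- The embedding of series in the outer variable. -/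
def embX : PowerSeries A →+* PowerSeries (PowerSeries A) := PowerSeries.map PowerSeries.C

/-- The embedding of series in the inner variable. -/
def embY : PowerSeries A →+* PowerSeries (PowerSeries A) := PowerSeries.C

/-- The embedding of series in the product of the two variables. -/
def embXY : PowerSeries A →+* PowerSeries (PowerSeries A) where
  toFun l := PowerSeries.mk fun n => monomial n (coeff n l)
  map_one' := by
    ext n m
    by_cases hn : n = 0 <;> simp [coeff_one, hn]
  map_mul' l m := by
    ext1 n
    simp only [coeff_mk, coeff_mul, map_sum]
    refine Finset.sum_congr rfl fun x hx => ?_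
    rw [monomial_mul_monomial, Finset.HasAntidiagonal.mem_antidiagonal.mp hx]
  map_zero' := by ext n; simp
  map_add' l m := by ext n; simp

theorem coeff_embX (α : ℕ) (l : PowerSeries A) : coeff α (embX l) = C (coeff α l) := coeff_map _ _ _

theorem coeff_embXY (α : ℕ) (l : PowerSeries A) :
    coeff α (embXY l) = monomial α (coeff α l) := by
  change coeff α (PowerSeries.mk fun n => monomial n (coeff n l)) = _
  rw [coeff_mk]

theorem coeff_embX_mul_embY (α n : ℕ) (a b : PowerSeries A) :
    coeff n (coeff α (embX a * embY b)) = coeff α a * coeff n b := by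
  rw [embY, coeff_mul_C, coeff_embX, coeff_C_mul]

theorem coeff_embY_mul_embX (α n : ℕ) (a b : PowerSeries A) :
    coeff n (coeff α (embY b * embX a)) = coeff n b * coeff α a := by
  rw [embY, coeff_C_mul, coeff_embX, coeff_mul_C]

theorem coeff_embXY_mul_embY (α n : ℕ) (a b : PowerSeries A) :
    coeff n (coeff α (embXY a * embY b)) = if α ≤ n then coeff α a * coeff (n - α) b else 0 := by
  rw [embY, coeff_mul_C, coeff_embXY, monomial_eq_C_mul_X_pow, mul_assoc, X_pow_mul, ← mul_assoc,
    coeff_mul_X_pow', coeff_C_mul]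

theorem coeff_embY_mul_embXY (α n : ℕ) (a b : PowerSeries A) :
    coeff n (coeff α (embY b * embXY a)) = if α ≤ n then coeff (n - α) b * coeff α a else 0 := by
  rw [embY, coeff_C_mul, coeff_embXY, monomial_eq_C_mul_X_pow, ← mul_assoc, coeff_mul_X_pow', coeff_mul_C]

variable [Algebra ℂ A]

/-- The substitution `X ↦ cX`. -/
def scale (c : ℂ) : PowerSeries A →ₐ[ℂ] PowerSeries A where
  toFun l := PowerSeries.mk fun n => c ^ n • coeff n l
  map_one' := by
    ext n
    by_cases hn : n = 0 <;> simp [coeff_one, hn]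
  map_mul' l m := by
    ext n
    simp only [coeff_mk, coeff_mul, Finset.smul_sum]
    refine Finset.sum_congr rfl fun x hx => ?_
    rw [← Finset.HasAntidiagonal.mem_antidiagonal.mp hx, pow_add, smul_mul_smul_comm]
  map_zero' := by ext n; simp
  map_add' l m := by ext n; simp
  commutes' r := by
    ext n
    by_cases hn : n = 0 <;> simp [PowerSeries.algebraMap_apply, coeff_C, hn]

@[simp] theorem coeff_scale (c : ℂ) (n : ℕ) (l : PowerSeries A) :
    coeff n (scale c l) = c ^ n • coeff n l := by
  change coeff n (PowerSeries.mk fun n => c ^ n • coeff n l) = _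
  rw [coeff_mk]

theorem scale_scale (c d : ℂ) (l : PowerSeries A) : scale c (scale d l) = scale (c * d) l := by
  ext n
  simp [smul_smul, mul_pow]

theorem scale_one (l : PowerSeries A) : scale 1 l = l := by
  ext n
  simp

theorem embX_smul (c : ℂ) (l : PowerSeries A) : embX (c • l) = c • embX l := by
  ext α n
  rw [coeff_embX, coeff_C, coeff_smul, coeff_smul, coeff_smul, coeff_embX, coeff_C]
  split_ifs <;> simp

theorem embY_smul (c : ℂ) (l : PowerSeries A) : embY (c • l) = c • embY l := by
  ext α n
  rw [embY, coeff_C, coeff_smul, coeff_smul, coeff_C]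
  split_ifs <;> simp

theorem embXY_smul (c : ℂ) (l : PowerSeries A) : embXY (c • l) = c • embXY l := by
  ext α n
  rw [coeff_embXY, coeff_monomial, coeff_smul, coeff_smul, coeff_smul, coeff_embXY, coeff_monomial]
  split_ifs <;> simp

/-- Scalar series in the outer variable. -/
def scalarX : PowerSeries ℂ →+* PowerSeries (PowerSeries A) :=
  embX.comp (PowerSeries.map (algebraMap ℂ A))

/-- Scalar series in the product of the two variables. -/
def scalarXY : PowerSeries ℂ →+* PowerSeries (PowerSeries A) :=
  embXY.comp (PowerSeries.map (algebraMap ℂ A))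

theorem coeff_scalarX (α : ℕ) (r : PowerSeries ℂ) :
    coeff α (scalarX (A := A) r) = algebraMap ℂ _ (coeff α r) := by
  simp [scalarX, coeff_embX, PowerSeries.algebraMap_apply]

theorem coeff_scalarXY (α : ℕ) (r : PowerSeries ℂ) :
    coeff α (scalarXY (A := A) r) = algebraMap ℂ _ (coeff α r) * X ^ α := by
  simp [scalarXY, coeff_embXY, PowerSeries.algebraMap_apply, monomial_eq_C_mul_X_pow]

theorem isCentralHom_scalarX : IsCentralHom (scalarX (A := A)) where
  central r x := by
    ext1 n
    rw [coeff_mul, coeff_mul, ← Finset.Nat.sum_antidiagonal_swap]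
    simp only [coeff_scalarX, Algebra.commutes, Prod.fst_swap, Prod.snd_swap]
  map_C c := by
    ext1 n
    by_cases hn : n = 0 <;> simp [coeff_scalarX, PowerSeries.algebraMap_apply, coeff_C, hn]

theorem isCentralHom_scalarXY : IsCentralHom (scalarXY (A := A)) where
  central r x := by
    ext1 n
    rw [coeff_mul, coeff_mul, ← Finset.Nat.sum_antidiagonal_swap]
    simp only [coeff_scalarXY, Prod.fst_swap, Prod.snd_swap]
    refine Finset.sum_congr rfl fun y _ => ?_
    rw [mul_assoc, X_pow_mul, ← mul_assoc, Algebra.commutes, mul_assoc]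
  map_C c := by
    ext1 n
    by_cases hn : n = 0 <;> simp [coeff_scalarXY, PowerSeries.algebraMap_apply, coeff_C, hn]

theorem coeff_scalarX_mul (α n : ℕ) (r : PowerSeries ℂ) (g : PowerSeries (PowerSeries A)) :
    coeff n (coeff α (scalarX r * g)) =
      ∑ m ∈ Finset.range (α + 1), coeff m r • coeff n (coeff (α - m) g) := by
  rw [coeff_mul, Finset.Nat.sum_antidiagonal_eq_sum_range_succ_mk, map_sum]
  refine Finset.sum_congr rfl fun m _ => ?_
  rw [coeff_scalarX, ← Algebra.smul_def, coeff_smul]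

theorem coeff_scalarXY_mul (α n : ℕ) (r : PowerSeries ℂ) (g : PowerSeries (PowerSeries A)) :
    coeff n (coeff α (scalarXY r * g)) =
      ∑ m ∈ Finset.range (min α n + 1), coeff m r • coeff (n - m) (coeff (α - m) g) := by
  rw [coeff_mul, Finset.Nat.sum_antidiagonal_eq_sum_range_succ_mk, map_sum]
  symm
  refine Finset.sum_subset_zero_on_sdiff (Finset.range_mono (by lia)) (fun m hm => ?_)
    fun m hm => ?_
  · have : ¬ m ≤ n := by simp at hm; lia
    rw [coeff_scalarXY, mul_assoc, ← Algebra.smul_def, coeff_smul, coeff_X_pow_mul', if_neg this,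
      smul_zero]
  · have : m ≤ n := by simp at hm; lia
    rw [coeff_scalarXY, mul_assoc, ← Algebra.smul_def, coeff_smul, coeff_X_pow_mul', if_pos this]

/-- The substitution `X ↦ cX`, `Y ↦ dY` in series in the outer variable `X` and the inner
variable `Y`. -/
def scale₂ (c d : ℂ) : PowerSeries (PowerSeries A) →+* PowerSeries (PowerSeries A) :=
  (scale c : PowerSeries (PowerSeries A) →ₐ[ℂ] _).toRingHom.comp
    (PowerSeries.map (scale d : PowerSeries A →ₐ[ℂ] _).toRingHom)

theorem coeff_scale₂ (c d : ℂ) (α n : ℕ) (g : PowerSeries (PowerSeries A)) :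
    coeff n (coeff α (scale₂ c d g)) = (c ^ α * d ^ n) • coeff n (coeff α g) := by
  simp [scale₂, smul_smul]

theorem scale₂_embX (c d : ℂ) (l : PowerSeries A) : scale₂ c d (embX l) = embX (scale c l) := by
  ext α n
  rw [coeff_scale₂, coeff_embX, coeff_embX, coeff_C, coeff_C]
  split_ifs with hn <;> simp [hn]

theorem scale₂_embY (c d : ℂ) (l : PowerSeries A) : scale₂ c d (embY l) = embY (scale d l) := by
  ext α n
  rw [coeff_scale₂, embY, coeff_C, coeff_C]
  split_ifs with hn <;> simp [hn]

theorem scale₂_embXY (c d : ℂ) (l : PowerSeries A) :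
    scale₂ c d (embXY l) = embXY (scale (c * d) l) := by
  ext α n
  rw [coeff_scale₂, coeff_embXY, coeff_embXY, coeff_monomial, coeff_monomial]
  split_ifs with hn <;> simp [hn, mul_pow]

theorem scale_map (c : ℂ) (r : PowerSeries ℂ) : scale c (PowerSeries.map (algebraMap ℂ A) r) =
    PowerSeries.map (algebraMap ℂ A) (PowerSeries.rescale c r) := by
  ext n
  simp [Algebra.smul_def]

theorem scale₂_scalarX (c d : ℂ) (r : PowerSeries ℂ) :
    scale₂ c d (scalarX (A := A) r) = scalarX (PowerSeries.rescale c r) := by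
  simp [scalarX, scale₂_embX, scale_map]

theorem scale₂_scalarXY (c d : ℂ) (r : PowerSeries ℂ) :
    scale₂ c d (scalarXY (A := A) r) = scalarXY (PowerSeries.rescale (c * d) r) := by
  simp [scalarXY, scale₂_embXY, scale_map]

end TwoVariables

/-! ### Existence of the quantum determinant -/

section QuantumDeterminant

open PowerSeries

variable {A : Type*} [Ring A]

/-- `∑ gₐₙ XᵃYⁿ` has only terms with `a ≤ n`. -/
def IsTriangular (g : PowerSeries (PowerSeries A)) : Prop :=
  ∀ α n, n < α → coeff n (coeff α g) = 0

theorem isTriangular_embXY_mul_embY (a b : PowerSeries A) : IsTriangular (embXY a * embY b) :=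
  fun α n hn => by rw [coeff_embXY_mul_embY, if_neg (by lia)]

theorem isTriangular_embY_mul_embXY (a b : PowerSeries A) : IsTriangular (embY b * embXY a) :=
  fun α n hn => by rw [coeff_embY_mul_embXY, if_neg (by lia)]

variable [Algebra ℂ A]

/-- Evaluation of the outer variable at `p`, for series whose `n`-th inner coefficient has
degree at most `n + 1`. -/
def evalX (p : ℂ) : PowerSeries (PowerSeries A) →ₗ[ℂ] PowerSeries A where
  toFun g := PowerSeries.mk fun n => ∑ α ∈ Finset.range (n + 2), p ^ α • coeff n (coeff α g)
  map_add' f g := by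
    ext n
    simp [Finset.sum_add_distrib]
  map_smul' c g := by
    ext n
    simp [Finset.smul_sum, smul_comm c]

theorem coeff_evalX (p : ℂ) (n : ℕ) (g : PowerSeries (PowerSeries A)) :
    coeff n (evalX p g) = ∑ α ∈ Finset.range (n + 2), p ^ α • coeff n (coeff α g) := by
  change coeff n (PowerSeries.mk fun n => ∑ α ∈ Finset.range (n + 2),
    p ^ α • coeff n (coeff α g)) = _
  rw [coeff_mk]

theorem evalX_embXY_mul_embY (p : ℂ) (a b : PowerSeries A) :
    evalX p (embXY a * embY b) = scale p a * b := by
  ext n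
  rw [coeff_evalX, coeff_mul, Finset.Nat.sum_antidiagonal_eq_sum_range_succ_mk,
    Finset.sum_range_succ, coeff_embXY_mul_embY, if_neg (by lia), smul_zero, add_zero]
  refine Finset.sum_congr rfl fun α hα => ?_
  rw [coeff_embXY_mul_embY, if_pos (by simpa [Nat.lt_succ_iff] using hα), coeff_scale,
    smul_mul_assoc]

theorem evalX_embY_mul_embXY (p : ℂ) (a b : PowerSeries A) :
    evalX p (embY b * embXY a) = b * scale p a := by
  ext n
  rw [coeff_evalX, coeff_mul, ← Finset.Nat.sum_antidiagonal_swap,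
    Finset.Nat.sum_antidiagonal_eq_sum_range_succ_mk,
    Finset.sum_range_succ, coeff_embY_mul_embXY, if_neg (by lia), smul_zero, add_zero]
  refine Finset.sum_congr rfl fun α hα => ?_
  rw [coeff_embY_mul_embXY, if_pos (by simpa [Nat.lt_succ_iff] using hα), Prod.fst_swap,
    Prod.snd_swap, coeff_scale, mul_smul_comm]

theorem evalX_scalarX_X_mul (p : ℂ) {g : PowerSeries (PowerSeries A)} (hg : IsTriangular g) :
    evalX p (scalarX X * g) = p • evalX p g := by
  have hX : scalarX (A := A) X = X := by
    simp [scalarX, embX]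
  ext n
  rw [coeff_smul, coeff_evalX, coeff_evalX, hX, Finset.sum_range_succ',
    Finset.sum_range_succ (fun α => p ^ α • coeff n (coeff α g)), hg (n + 1) n (by lia)]
  simp [coeff_succ_X_mul, Finset.smul_sum, smul_smul, pow_succ']

theorem evalX_scalarX_affine_mul (p a b : ℂ) {g : PowerSeries (PowerSeries A)}
    (hg : IsTriangular g) :
    evalX p (scalarX (C a + C b * X) * g) = (a + b * p) • evalX p g := by
  rw [map_add scalarX, map_mul scalarX, isCentralHom_scalarX.map_C, isCentralHom_scalarX.map_C,
    add_mul, mul_assoc,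
    ← Algebra.smul_def, ← Algebra.smul_def, map_add, map_smul, map_smul, evalX_scalarX_X_mul p hg,
    smul_smul, add_smul]

theorem exists_isQDet {h : ℂ} (hh : h.re < 0) {M N : Fin 2 → Fin 2 → PowerSeries (PowerSeries A)}
    {M' N' : Fin 2 → Fin 2 → PowerSeries A} (H : SeriesRLL h scalarX 1 1 M N)
    (hMN : ∀ i j k l, IsTriangular (M i j * N k l))
    (hNM : ∀ i j k l, IsTriangular (N i j * M k l))
    (hE : ∀ i j k l, evalX (Complex.exp h ^ 2) (M i j * N k l) = M' i j * N' k l) :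
    ∃ D, IsQDet (Complex.exp h) M' N' D := by
  obtain ⟨U, hU⟩ := exists_mul_RSer_eq hh
  have hq0 := Complex.exp_ne_zero h
  have hq1 : 1 - Complex.exp h ^ 2 ≠ 0 := fun h0 => by
    have h1 : ‖Complex.exp h ^ 2‖ < 1 := by
      rw [norm_pow]
      exact pow_lt_one₀ (norm_nonneg _) (norm_exp_lt_one hh) (by norm_num)
    rw [← sub_eq_zero.mp h0] at h1
    simp at h1
  set q := Complex.exp h
  have hev : ∀ u v x, IsTriangular x → evalX (q ^ 2) (scalarX (A := A) (U * RSer h u v) * x) =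
      ((1 - q ^ 2) * sixVertex 0 1 (-q) (-q⁻¹) u v) • evalX (q ^ 2) x := by
    intro u v x hx
    rw [show U * RSer h u v = _ from congrFun (congrFun hU u) v]
    unfold sixVertex
    split_ifs
    · have := evalX_scalarX_affine_mul (q ^ 2) q (-q⁻¹) hx
      rw [show q + -q⁻¹ * q ^ 2 = (1 - q ^ 2) * 0 by field_simp; ring] at this
      simpa [sub_eq_add_neg] using this
    · have := evalX_scalarX_affine_mul (q ^ 2) 1 (-1) hx
      rw [show 1 + (-1) * q ^ 2 = (1 - q ^ 2) * 1 by ring] at this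
      simpa [sub_eq_add_neg] using this
    · have := evalX_scalarX_affine_mul (q ^ 2) 0 (q - q⁻¹) hx
      rw [show 0 + (q - q⁻¹) * q ^ 2 = (1 - q ^ 2) * (-q) by field_simp; ring] at this
      simpa using this
    · have := evalX_scalarX_affine_mul (q ^ 2) (q - q⁻¹) 0 hx
      rw [show q - q⁻¹ + 0 * q ^ 2 = (1 - q ^ 2) * (-q⁻¹) by field_simp; ring] at this
      simpa using this
    · simp
  have key : ∀ j b : Fin 2, ∑ p : Fin 2, ∑ c : Fin 2,
      sixVertex 0 1 (-q) (-q⁻¹) ((0 : Fin 2), (1 : Fin 2)) (p, c) • (M' p j * N' c b) =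
      ∑ p : Fin 2, ∑ c : Fin 2, sixVertex 0 1 (-q) (-q⁻¹) (p, c) (j, b) •
        evalX (q ^ 2) (N 1 c * M 0 p) := by
    intro j b
    have h1 := congrArg (fun g => evalX (q ^ 2) (scalarX U * g)) (H 0 1 j b)
    simp only [PowerSeries.rescale_one, RingHom.id_apply, Finset.mul_sum, ← mul_assoc (scalarX U),
      ← map_mul scalarX, map_sum, hev _ _ _ (hMN _ _ _ _), hev _ _ _ (hNM _ _ _ _), mul_smul,
      ← Finset.smul_sum, hE] at h1
    exact (IsUnit.mk0 _ hq1).smul_left_cancel.mp h1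
  refine ⟨evalX (q ^ 2) (N 1 1 * M 0 0) - q⁻¹ • evalX (q ^ 2) (N 1 0 * M 0 1), fun j b => ?_⟩
  have h1 := key j b
  have h2 : ∑ a : Fin 2, ∑ c : Fin 2, qAnti q a c • (M' a j * N' c b) =
      ∑ p : Fin 2, ∑ c : Fin 2,
        sixVertex 0 1 (-q) (-q⁻¹) ((0 : Fin 2), (1 : Fin 2)) (p, c) • (M' p j * N' c b) := by
    simp [qAnti, sixVertex]
  rw [h2, h1]
  fin_cases j <;> fin_cases b <;>
    simp [qAnti, sixVertex, smul_sub, smul_smul, hq0]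
  abel

end QuantumDeterminant

/-! ### Centrality of the coefficients of the quantum determinants -/

section Centrality

open PowerSeries

variable {A : Type*} [Ring A]

theorem commute_coeff_of_embX_embY {a b : PowerSeries A} (H : Commute (embX a) (embY b))
    (m n : ℕ) : Commute (coeff m a) (coeff n b) := by
  have := congrArg (fun g => coeff n (coeff m g)) H.eq
  rw [commute_iff_eq]
  simpa only [coeff_embX_mul_embY, coeff_embY_mul_embX] using this

theorem commute_coeff_of_embXY_embY {a b : PowerSeries A} (H : Commute (embXY a) (embY b))
    (m n : ℕ) : Commute (coeff m a) (coeff n b) := by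
  have := congrArg (fun g => coeff (m + n) (coeff m g)) H.eq
  rw [commute_iff_eq]
  simpa only [coeff_embXY_mul_embY, coeff_embY_mul_embXY, le_add_iff_nonneg_right, zero_le,
    if_true, Nat.add_sub_cancel_left] using this

variable [Algebra ℂ A] {h κ κ' : ℂ} {lp lm : Fin 2 → Fin 2 → PowerSeries A}
  {D : PowerSeries A}

theorem exists_isQDet_plus (hh : h.re < 0)
    (H : SeriesRLL h scalarX 1 1 (fun i j => embXY (lp i j)) (fun i j => embY (lp i j))) :
    ∃ D, IsQDet (Complex.exp h) (fun i j => scale (Complex.exp h ^ 2) (lp i j)) lp D :=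
  exists_isQDet hh H (fun _ _ _ _ => isTriangular_embXY_mul_embY _ _)
    (fun _ _ _ _ => isTriangular_embY_mul_embXY _ _) fun _ _ _ _ => evalX_embXY_mul_embY _ _ _

theorem exists_isQDet_minus (hh : h.re < 0)
    (H : SeriesRLL h scalarX 1 1 (fun i j => embY (lm i j)) (fun i j => embXY (lm i j))) :
    ∃ D, IsQDet (Complex.exp h) (fun i j => scale (Complex.exp h ^ 2)⁻¹ (lm i j)) lm D := by
  obtain ⟨D, hD⟩ := exists_isQDet (N' := fun i j => scale (Complex.exp h ^ 2) (lm i j)) hh H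
    (fun _ _ _ _ => isTriangular_embY_mul_embXY _ _)
    (fun _ _ _ _ => isTriangular_embXY_mul_embY _ _) fun _ _ _ _ => evalX_embY_mul_embXY _ _ _
  have := hD.map (scale (Complex.exp h ^ 2)⁻¹).toRingHom fun c x =>
    map_smul (scale (Complex.exp h ^ 2)⁻¹) c x
  simp only [AlgHom.toRingHom_eq_coe, RingHom.coe_coe, scale_scale, inv_mul_cancel₀ (pow_ne_zero 2 (Complex.exp_ne_zero h)),
    scale_one] at this
  exact ⟨_, this⟩

theorem commute_coeff_plus_plus (hh : h.re < 0)
    (H : SeriesRLL h scalarX 1 1 (fun i j => embXY (lp i j)) (fun i j => embY (lp i j)))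
    (hD : IsQDet (Complex.exp h) (fun i j => scale (Complex.exp h ^ 2) (lp i j)) lp D)
    (i j : Fin 2) (m n : ℕ) : Commute (coeff m (lp i j)) (coeff n D) := by
  have hq := pow_ne_zero 2 (Complex.exp_ne_zero h)
  set q := Complex.exp h
  have H' := H.map (scale₂ (q ^ 2)⁻¹ (q ^ 2)) (scale₂_scalarX _ _)
  simp only [scale₂_embXY, scale₂_embY, inv_mul_cancel₀ hq, scale_one, one_mul] at H'
  rw [← mul_inv_cancel₀ hq] at H
  have hD' := hD.map embY embY_smul
  have hc := H.commute_right isCentralHom_scalarX hh H' hD' i j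
  exact commute_coeff_of_embXY_embY hc m n

theorem commute_coeff_minus_minus (hh : h.re < 0)
    (H : SeriesRLL h scalarX 1 1 (fun i j => embY (lm i j)) (fun i j => embXY (lm i j)))
    (hD : IsQDet (Complex.exp h) (fun i j => scale (Complex.exp h ^ 2)⁻¹ (lm i j)) lm D)
    (i j : Fin 2) (m n : ℕ) : Commute (coeff m (lm i j)) (coeff n D) := by
  have hq := pow_ne_zero 2 (Complex.exp_ne_zero h)
  set q := Complex.exp h
  have H' := H.map (scale₂ (q ^ 2)⁻¹ 1) (scale₂_scalarX _ _)
  simp only [scale₂_embXY, scale₂_embY, scale_one, one_mul, mul_one] at H'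
  rw [← mul_inv_cancel₀ hq] at H
  have hD' := hD.map embXY embXY_smul
  have hc := H.commute_right isCentralHom_scalarX hh H' hD' i j
  exact (commute_coeff_of_embXY_embY hc.symm n m).symm

theorem commute_coeff_plus_minus (hh : h.re < 0)
    (H : SeriesRLL h scalarXY κ κ' (fun i j => embX (lp i j)) (fun i j => embY (lm i j)))
    (hD : IsQDet (Complex.exp h) (fun i j => scale (Complex.exp h ^ 2)⁻¹ (lm i j)) lm D)
    (i j : Fin 2) (m n : ℕ) : Commute (coeff m (lp i j)) (coeff n D) := by
  have hq := pow_ne_zero 2 (Complex.exp_ne_zero h)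
  set q := Complex.exp h
  have H' := H.map (scale₂ 1 (q ^ 2)⁻¹) (scale₂_scalarXY _ _)
  simp only [scale₂_embX, scale₂_embY, scale_one, one_mul] at H'
  rw [← mul_inv_cancel_right₀ hq κ, ← mul_inv_cancel_right₀ hq κ', mul_right_comm,
    mul_right_comm κ', mul_comm _ (q ^ 2), mul_comm _ (q ^ 2)] at H
  have hD' := hD.map embY embY_smul
  have hc := H.commute_right isCentralHom_scalarXY hh H' hD' i j
  exact commute_coeff_of_embX_embY hc m n

theorem commute_coeff_minus_plus (hh : h.re < 0)
    (H : SeriesRLL h scalarXY κ κ' (fun i j => embX (lp i j)) (fun i j => embY (lm i j)))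
    (hD : IsQDet (Complex.exp h) (fun i j => scale (Complex.exp h ^ 2) (lp i j)) lp D)
    (i j : Fin 2) (m n : ℕ) : Commute (coeff m (lm i j)) (coeff n D) := by
  set q := Complex.exp h
  have H' := H.map (scale₂ (q ^ 2) 1) (scale₂_scalarXY _ _)
  simp only [scale₂_embX, scale₂_embY, scale_one, mul_one] at H'
  rw [mul_comm κ, mul_comm κ'] at H'
  have hD' := hD.map embX embX_smul
  have hc := H'.commute_left isCentralHom_scalarXY hh H hD' i j
  exact (commute_coeff_of_embX_embY hc n m).symm

end Centrality

/-! ### The generating series in `U'_h(ĝl₂)_k` -/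

theorem map_seriesInv {R R' : Type*} [Ring R] [Ring R'] (φ : R →+* R') (a : ℕ → R) (a0' : R)
    (n : ℕ) : φ (seriesInv a a0' n) = seriesInv (fun m => φ (a m)) (φ a0') n := by
  induction n using Nat.strong_induction_on with
  | _ n ih =>
    cases n with
    | zero => simp [seriesInv]
    | succ n =>
      rw [seriesInv, seriesInv, map_neg, map_mul, map_sum]
      congr 2
      refine Finset.sum_congr rfl fun j _ => ?_
      rw [map_mul, ih j.1 (Finset.mem_range.mp j.2)]

theorem mk_mul_mk_seriesInv {R : Type*} [Ring R] {a : ℕ → R} {a0' : R} (h : a 0 * a0' = 1) :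
    PowerSeries.mk a * PowerSeries.mk (seriesInv a a0') = 1 := by
  ext n
  cases n with
  | zero => simp [seriesInv, h]
  | succ n =>
    rw [PowerSeries.coeff_mul, ← Finset.Nat.sum_antidiagonal_swap,
      Finset.Nat.sum_antidiagonal_eq_sum_range_succ_mk, Finset.sum_range_succ]
    simp only [PowerSeries.coeff_mk, Prod.fst_swap, Prod.snd_swap, Nat.sub_self]
    rw [seriesInv, Finset.sum_attach (Finset.range (n + 1))
      fun j => a (n + 1 - j) * seriesInv a a0' j, mul_neg, ← mul_assoc, h, one_mul]
    simp [PowerSeries.coeff_one]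

theorem coeff_mk_sub_mul {R : Type*} [Ring R] (x y v z : ℕ → R) (n : ℕ) :
    PowerSeries.coeff n (PowerSeries.mk x - PowerSeries.mk y * PowerSeries.mk v * PowerSeries.mk z)
      = x n - ∑ a ∈ Finset.range (n + 1), ∑ b ∈ Finset.range (n + 1 - a),
        y a * v b * z (n - a - b) := by
  rw [map_sub, PowerSeries.coeff_mk, mul_assoc, PowerSeries.coeff_mul,
    Finset.Nat.sum_antidiagonal_eq_sum_range_succ_mk]
  congr 1
  refine Finset.sum_congr rfl fun a ha => ?_
  have ha' : a ≤ n := Nat.lt_succ_iff.mp (Finset.mem_range.mp ha)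
  rw [PowerSeries.coeff_mul, Finset.Nat.sum_antidiagonal_eq_sum_range_succ_mk, Finset.mul_sum,
    Nat.succ_eq_add_one, Nat.sub_add_comm ha']
  simp [mul_assoc]

theorem coeff_RSer (h : ℂ) (u v : Fin 2 × Fin 2) (m : ℕ) :
    PowerSeries.coeff m (RSer h u v) = RC h u v m := PowerSeries.coeff_mk _ _

theorem exp_two_mul_mul (h : ℂ) (j : ℕ) :
    Complex.exp (2 * h * j) = (Complex.exp h ^ 2) ^ j := by
  rw [← pow_mul, ← Complex.exp_nat_mul]
  push_cast
  ring_nf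

theorem exp_neg_two_mul_mul (h : ℂ) (j : ℕ) :
    Complex.exp (-2 * h * j) = (Complex.exp h ^ 2)⁻¹ ^ j := by
  rw [inv_pow, ← exp_two_mul_mul, ← Complex.exp_neg]
  ring_nf

section Generators

variable (h k : ℂ)

/-- The series `l^+_{ij}(z)`. -/
def lpSer (i j : Fin 2) : PowerSeries (Uhgl2RS h k) :=
  PowerSeries.mk fun n => rsMk h k (lpG i j n)

/-- The series `l^-_{ij}(z)`, in the variable `z⁻¹`. -/
def lmSer (i j : Fin 2) : PowerSeries (Uhgl2RS h k) :=
  PowerSeries.mk fun n => rsMk h k (lmG i j n)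

theorem coeff_lpSer (i j : Fin 2) (n : ℕ) :
    PowerSeries.coeff n (lpSer h k i j) = rsMk h k (lpG i j n) := PowerSeries.coeff_mk _ _

theorem coeff_lmSer (i j : Fin 2) (n : ℕ) :
    PowerSeries.coeff n (lmSer h k i j) = rsMk h k (lmG i j n) := PowerSeries.coeff_mk _ _

theorem lpG_of_neg (i j : Fin 2) {n : ℤ} (hn : n < 0) : lpG i j n = 0 := if_neg (by lia)

theorem lmG_of_neg (i j : Fin 2) {n : ℤ} (hn : n < 0) : lmG i j n = 0 := if_neg (by lia)

theorem rsMk_rel {x y : RSFA} (H : RSRel h k x y) : rsMk h k x = rsMk h k y :=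
  RingQuot.mkAlgHom_rel ℂ H

theorem commute_of_commute_generators {d : Uhgl2RS h k}
    (hp : ∀ i j m, Commute (PowerSeries.coeff m (lpSer h k i j)) d)
    (hm : ∀ i j m, Commute (PowerSeries.coeff m (lmSer h k i j)) d) (x : Uhgl2RS h k) :
    Commute x d := by
  obtain ⟨y, rfl⟩ : ∃ y, rsMk h k y = x := RingQuot.mkAlgHom_surjective ℂ (RSRel h k) x
  induction y using FreeAlgebra.induction with
  | grade0 r =>
    rw [AlgHom.commutes]
    exact Algebra.commutes r d
  | grade1 g =>
    rcases g with ⟨i, j, n⟩ | ⟨i, j, n⟩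
    · simpa [coeff_lpSer, lpG] using hp i j n
    · simpa [coeff_lmSer, lmG] using hm i j n
  | mul a b ha hb =>
    rw [map_mul]
    exact ha.mul_left hb
  | add a b ha hb =>
    rw [map_add]
    exact ha.add_left hb

theorem seriesRLL_plus_plus : SeriesRLL h scalarX 1 1 (fun i j => embXY (lpSer h k i j))
    (fun i j => embY (lpSer h k i j)) := by
  intro i a j b
  ext α n
  have H := rsMk_rel h k (RSRel.RLLpp i a j b (α : ℤ) ((n : ℤ) - α))
  simp only [map_sum, map_smul, map_mul, Int.toNat_natCast] at H
  simp only [PowerSeries.rescale_one, RingHom.id_apply, map_sum, coeff_scalarX_mul]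
  convert H using 5 with p _ c _ m hm p _ c _ m hm
  any_goals exact coeff_RSer _ _ _ _
  all_goals
    have hm' : m ≤ α := Nat.lt_succ_iff.mp (Finset.mem_range.mp hm)
    first | rw [coeff_embXY_mul_embY] | rw [coeff_embY_mul_embXY]
    simp only [coeff_lpSer]
    split_ifs with hn
    · rw [show ((α - m : ℕ) : ℤ) = α - m by lia,
        show ((n - (α - m) : ℕ) : ℤ) = (n : ℤ) - α + m by lia]
    · rw [lpG_of_neg _ _ (show (n : ℤ) - α + m < 0 by lia), map_zero]
      simp

theorem seriesRLL_minus_minus : SeriesRLL h scalarX 1 1 (fun i j => embY (lmSer h k i j))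
    (fun i j => embXY (lmSer h k i j)) := by
  intro i a j b
  ext β n
  have H := rsMk_rel h k (RSRel.RLLmm i a j b ((n : ℤ) - β) (β : ℤ))
  simp only [map_sum, map_smul, map_mul, Int.toNat_natCast] at H
  simp only [PowerSeries.rescale_one, RingHom.id_apply, map_sum, coeff_scalarX_mul]
  convert H using 5 with p _ c _ m hm p _ c _ m hm
  any_goals exact coeff_RSer _ _ _ _
  all_goals
    have hm' : m ≤ β := Nat.lt_succ_iff.mp (Finset.mem_range.mp hm)
    first | rw [coeff_embXY_mul_embY] | rw [coeff_embY_mul_embXY]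
    simp only [coeff_lmSer]
    split_ifs with hn
    · rw [show ((β - m : ℕ) : ℤ) = β - m by lia,
        show ((n - (β - m) : ℕ) : ℤ) = (n : ℤ) - β + m by lia]
    · rw [lmG_of_neg _ _ (show (n : ℤ) - β + m < 0 by lia), map_zero]
      simp

theorem seriesRLL_plus_minus : SeriesRLL h scalarXY (Complex.exp (-(h * k)))
    (Complex.exp (h * k)) (fun i j => embX (lpSer h k i j)) (fun i j => embY (lmSer h k i j)) := by
  intro i a j b
  ext α β
  have H := rsMk_rel h k (RSRel.RLLpm i a j b (α : ℤ) (β : ℤ))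
  simp only [map_sum, map_smul, map_mul, ← Nat.cast_min, Int.toNat_natCast] at H
  simp only [map_sum, coeff_scalarXY_mul]
  convert H using 5 with p _ c _ m hm p _ c _ m hm
  any_goals rw [PowerSeries.coeff_rescale, coeff_RSer, ← Complex.exp_nat_mul, mul_comm (m : ℂ)]
  all_goals
    have hm' : m ≤ α ∧ m ≤ β := by
      simpa [Nat.lt_succ_iff] using hm
    first | rw [coeff_embX_mul_embY] | rw [coeff_embY_mul_embX]
    rw [coeff_lpSer, coeff_lmSer, show ((α - m : ℕ) : ℤ) = α - m by lia,
      show ((β - m : ℕ) : ℤ) = β - m by lia]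

theorem rsMk_Dp (n : ℕ) : rsMk h k (Dp h n) =
    PowerSeries.coeff n (scale (Complex.exp h ^ 2) (lpSer h k 0 0) *
      (lpSer h k 1 1 - lpSer h k 1 0 * PowerSeries.mk (fun n => rsMk h k (invLp11 n)) *
        lpSer h k 0 1)) - if n = 0 then 1 else 0 := by
  rw [Dp, map_sub, PowerSeries.coeff_mul, Finset.Nat.sum_antidiagonal_eq_sum_range_succ_mk, map_sum,
    apply_ite (rsMk h k), map_one, map_zero]
  congr 1
  refine Finset.sum_congr rfl fun j _ => ?_
  rw [lpSer, lpSer, lpSer, lpSer, coeff_mk_sub_mul, coeff_scale, PowerSeries.coeff_mk, map_smul,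
    map_mul, smul_mul_assoc, kk2p, map_sub, map_sum, exp_two_mul_mul]
  congr 3
  refine Finset.sum_congr rfl fun a ha => ?_
  rw [map_sum]
  refine Finset.sum_congr rfl fun b hb => ?_
  rw [Finset.mem_range] at ha hb
  rw [map_mul, map_mul, show ((n - j - a - b : ℕ) : ℤ) = ((n - j : ℕ) : ℤ) - a - b by lia]

theorem rsMk_Dm (n : ℕ) : rsMk h k (Dm h n) =
    PowerSeries.coeff n (scale (Complex.exp h ^ 2)⁻¹ (lmSer h k 0 0) *
      (lmSer h k 1 1 - lmSer h k 1 0 * PowerSeries.mk (fun n => rsMk h k (invLm11 n)) *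
        lmSer h k 0 1)) - if n = 0 then 1 else 0 := by
  rw [Dm, map_sub, PowerSeries.coeff_mul, Finset.Nat.sum_antidiagonal_eq_sum_range_succ_mk, map_sum,
    apply_ite (rsMk h k), map_one, map_zero]
  congr 1
  refine Finset.sum_congr rfl fun j _ => ?_
  rw [lmSer, lmSer, lmSer, lmSer, coeff_mk_sub_mul, coeff_scale, PowerSeries.coeff_mk, map_smul,
    map_mul, smul_mul_assoc, kk2m, map_sub, map_sum, exp_neg_two_mul_mul]
  congr 3
  refine Finset.sum_congr rfl fun a ha => ?_
  rw [map_sum]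
  refine Finset.sum_congr rfl fun b hb => ?_
  rw [Finset.mem_range] at ha hb
  rw [map_mul, map_mul, show ((n - j - a - b : ℕ) : ℤ) = ((n - j : ℕ) : ℤ) - a - b by lia]

theorem lpSer_mul_inv :
    lpSer h k 0 0 * PowerSeries.mk (fun n => rsMk h k (invLp11 n)) = 1 := by
  have hi : (fun n => rsMk h k (invLp11 n)) =
      seriesInv (fun n : ℕ => rsMk h k (lpG 0 0 n)) (rsMk h k (lmG 0 0 0)) :=
    funext fun n => map_seriesInv (rsMk h k : RSFA →+* Uhgl2RS h k) _ _ n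
  rw [hi, lpSer]
  refine mk_mul_mk_seriesInv ?_
  rw [Nat.cast_zero, ← map_mul, rsMk_rel h k (RSRel.diagPM 0), map_one]

theorem lmSer_mul_inv :
    lmSer h k 0 0 * PowerSeries.mk (fun n => rsMk h k (invLm11 n)) = 1 := by
  have hi : (fun n => rsMk h k (invLm11 n)) =
      seriesInv (fun n : ℕ => rsMk h k (lmG 0 0 n)) (rsMk h k (lpG 0 0 0)) :=
    funext fun n => map_seriesInv (rsMk h k : RSFA →+* Uhgl2RS h k) _ _ n
  rw [hi, lmSer]
  refine mk_mul_mk_seriesInv ?_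
  rw [Nat.cast_zero, ← map_mul, rsMk_rel h k (RSRel.diagMP 0), map_one]

end Generators

/-- In `U'_h(ĝl₂)_k`, every Fourier coefficient of the power series
`l^±_{11}(zq²)·(l^±_{22}(z) − l^±_{21}(z)l^±_{11}(z)⁻¹l^±_{12}(z)) − 1` is a central
element. -/
theorem central_coefficients_Uhgl2RS (h k : ℂ) (hh : h.re < 0) (n : ℕ) :
    (∀ x : Uhgl2RS h k, rsMk h k (Dp h n) * x = x * rsMk h k (Dp h n)) ∧
    (∀ x : Uhgl2RS h k, rsMk h k (Dm h n) * x = x * rsMk h k (Dm h n)) := by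
  have hpp := seriesRLL_plus_plus h k
  have hmm := seriesRLL_minus_minus h k
  have hpm := seriesRLL_plus_minus h k
  have hone : ∀ x : Uhgl2RS h k, Commute x (if n = 0 then 1 else 0) := fun x => by
    split_ifs
    exacts [Commute.one_right x, Commute.zero_right x]
  constructor
  · obtain ⟨D, hD⟩ := exists_isQDet_plus hh hpp
    intro x
    rw [rsMk_Dp, ← hD.eq_mul_schur (lpSer_mul_inv h k)]
    exact ((commute_of_commute_generators h k
      (fun i j m => commute_coeff_plus_plus hh hpp hD i j m n)
      (fun i j m => commute_coeff_minus_plus hh hpm hD i j m n) x).sub_right (hone x)).symm.eq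
  · obtain ⟨D, hD⟩ := exists_isQDet_minus hh hmm
    intro x
    rw [rsMk_Dm, ← hD.eq_mul_schur (lmSer_mul_inv h k)]
    exact ((commute_of_commute_generators h k
      (fun i j m => commute_coeff_plus_minus hh hpm hD i j m n)
      (fun i j m => commute_coeff_minus_minus hh hmm hD i j m n) x).sub_right (hone x)).symm.eq

end
end

section
/- Let q ∈ ℂ∖{0} and let Λ : ℂ∖{0} → ℂ∖{0} be a nowhere-vanishing function. For every integer n ≥ 0 define ℓ^(n)(z) = Σ_{k=0}^{n} ( ∏_{j=0}^{k−1} Λ(zq^{2j−1})^{−1} )·( ∏_{j=k+1}^{n} Λ(zq^{2j−1}) ), so that ℓ^(0)(z) = 1 and ℓ^(1)(z) = Λ(zq) + Λ(zq^{−1})^{−1}. Then for every n ≥ 1 and every z ≠ 0 the fusion relation ℓ^(1)(zq^{2n})·ℓ^(n)(z) = ℓ^(n+1)(z) + ℓ^(n−1)(z) holds. -/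
open Finset

/-- Appending one factor to the sums of mixed products of `b` and `a`. -/
theorem sum_prod_range_mul_prod_Icc_succ {R : Type*} [CommSemiring R] (a b : ℕ → R) (m : ℕ) :
    ∑ k ∈ Finset.range (m + 1 + 1),
        (∏ j ∈ Finset.range k, b j) * (∏ j ∈ Finset.Icc (k + 1) (m + 1), a j) =
      a (m + 1) * (∑ k ∈ Finset.range (m + 1),
        (∏ j ∈ Finset.range k, b j) * (∏ j ∈ Finset.Icc (k + 1) m, a j)) +
      ∏ j ∈ Finset.range (m + 1), b j := by
  rw [Finset.sum_range_succ, Finset.mul_sum]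
  congr 1
  · refine Finset.sum_congr rfl fun k hk => ?_
    have hk' : k + 1 ≤ m + 1 := by simpa using hk
    rw [Finset.prod_Icc_succ_top hk']
    ring
  · simp

/-- The fusion relation `ℓ⁽¹⁾(zq^{2n})·ℓ⁽ⁿ⁾(z) = ℓ⁽ⁿ⁺¹⁾(z) + ℓ⁽ⁿ⁻¹⁾(z)` for the
generating functions `ℓ⁽ⁿ⁾(z) = Σ_{k=0}^{n} (∏_{j=0}^{k−1} Λ(zq^{2j−1})⁻¹)(∏_{j=k+1}^{n} Λ(zq^{2j−1}))`. -/
theorem fusion_relation (q : ℂ) (hq : q ≠ 0)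
    (Λ : ℂ → ℂ) (hΛ : ∀ z : ℂ, z ≠ 0 → Λ z ≠ 0)
    (ℓ : ℕ → ℂ → ℂ)
    (hℓ : ∀ (n : ℕ) (z : ℂ), ℓ n z =
      ∑ k ∈ Finset.range (n + 1),
        (∏ j ∈ Finset.range k, (Λ (z * q ^ (2 * (j : ℤ) - 1)))⁻¹) *
        (∏ j ∈ Finset.Icc (k + 1) n, Λ (z * q ^ (2 * (j : ℤ) - 1)))) :
    ∀ (n : ℕ), 1 ≤ n → ∀ z : ℂ, z ≠ 0 →
      ℓ 1 (z * q ^ (2 * n)) * ℓ n z = ℓ (n + 1) z + ℓ (n - 1) z := by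
  intro n hn z hz
  obtain ⟨m, rfl⟩ := Nat.exists_eq_succ_of_ne_zero (Nat.one_le_iff_ne_zero.mp hn)
  set a : ℕ → ℂ := fun j => Λ (z * q ^ (2 * (j : ℤ) - 1)) with ha
  have ha0 : a (m + 1) ≠ 0 := hΛ _ (mul_ne_zero hz (zpow_ne_zero _ hq))
  have h_succ (k : ℕ) : ℓ (k + 1) z =
      a (k + 1) * ℓ k z + ∏ j ∈ Finset.range (k + 1), (a j)⁻¹ := by
    rw [hℓ, hℓ]
    exact sum_prod_range_mul_prod_Icc_succ a (fun j => (a j)⁻¹) k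
  have h_one : ℓ 1 (z * q ^ (2 * (m + 1))) = a (m + 2) + (a (m + 1))⁻¹ := by
    have h_up : z * q ^ (2 * (m + 1)) * q = z * q ^ (2 * ((m + 2 : ℕ) : ℤ) - 1) := by
      rw [mul_assoc, ← pow_succ, ← zpow_natCast]
      congr 2
      push_cast
      ring
    have h_down : z * q ^ (2 * (m + 1)) * q⁻¹ = z * q ^ (2 * ((m + 1 : ℕ) : ℤ) - 1) := by
      rw [mul_assoc, zpow_sub_one₀ hq, ← zpow_natCast]
      push_cast
      rfl
    simp only [ha, ← h_up, ← h_down]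
    simp [hℓ, Finset.sum_range_succ]
  simp only [Nat.succ_eq_add_one, Nat.add_sub_cancel]
  rw [h_one, h_succ (m + 1), Finset.prod_range_succ, h_succ m]
  field_simp
  ring
end

section
/- Let N ≥ 2 be an integer, q ∈ ℂ with q ≠ 0 and q² ≠ 1, and m ∈ ℤ with q^{2Nm} ≠ 1. Let A = (A_{ij})_{1≤i,j≤N−1} be the Cartan matrix of sl_N (A_{ii} = 2, A_{ij} = −1 if |i−j| = 1, A_{ij} = 0 otherwise). Define the (N−1)×(N−1) matrices B^(m) and C^(m) by B^(m)_{ij} = [A_{ij}·m]_q and C^(m)_{ij} = [(N − max(i,j))m]_q·[min(i,j)·m]_q / [Nm]_q. Then B^(m)·C^(m) = [m]_q²·I_{N−1}, i.e. Σ_{k=1}^{N−1} [A_{ik}m]_q·C^(m)_{kj} = [m]_q²·δ_{ij} for all 1 ≤ i,j ≤ N−1. -/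
/-- The q-integer `[n]_q = (qⁿ − q⁻ⁿ)/(q − q⁻¹)`. -/
noncomputable def qint (q : ℂ) (n : ℤ) : ℂ := (q ^ n - q ^ (-n)) / (q - q⁻¹)

open Finset

lemma qint_zero (q : ℂ) : qint q 0 = 0 := by
  simp [qint]

lemma qint_neg (q : ℂ) (n : ℤ) : qint q (-n) = -qint q n := by
  simp only [qint, neg_neg]
  ring

lemma qint_ne_zero {q : ℂ} (hq : q ≠ 0) (hq2 : q ^ 2 ≠ 1) {n : ℤ} (hn : q ^ (2 * n) ≠ 1) :
    qint q n ≠ 0 := by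
  refine div_ne_zero (fun h => hn ?_) (fun h => hq2 ?_)
  · rw [two_mul, zpow_add₀ hq]
    nth_rewrite 1 [sub_eq_zero.mp h]
    rw [← zpow_add₀ hq, neg_add_cancel, zpow_zero]
  · rw [pow_two]
    nth_rewrite 1 [sub_eq_zero.mp h]
    exact inv_mul_cancel₀ hq

/-- The three-term recurrence `[2m][n] = [m]([n + m] + [n - m])`. -/
lemma qint_two_mul_mul (q : ℂ) (hq : q ≠ 0) (m n : ℤ) :
    qint q (2 * m) * qint q n = qint q m * (qint q (n - m) + qint q (n + m)) := by
  simp only [qint, zpow_neg, zpow_add₀ hq, zpow_sub₀ hq, two_mul]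
  have hm := zpow_ne_zero m hq
  have hn := zpow_ne_zero n hq
  generalize q ^ m = x at *
  generalize q ^ n = y at *
  generalize q - q⁻¹ = d
  field_simp
  ring

lemma qint_two_mul_mul_mul (q : ℂ) (hq : q ≠ 0) (m a b : ℤ) :
    qint q (2 * m) * (qint q a * qint q b)
      - qint q m * (qint q a * qint q (b - m) + qint q (a - m) * qint q b)
      = qint q m ^ 2 * qint q (a + b) := by
  simp only [qint, zpow_neg, zpow_add₀ hq, zpow_sub₀ hq, two_mul]
  have hm := zpow_ne_zero m hq
  have ha := zpow_ne_zero a hq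
  have hb := zpow_ne_zero b hq
  generalize q ^ m = x at *
  generalize q ^ a = y at *
  generalize q ^ b = z at *
  generalize q - q⁻¹ = d
  field_simp
  ring

/-- A tridiagonal row applied to a sequence `F` with `F 0 = F (n + 1) = 0`. -/
lemma sum_tridiagonal {R : Type*} [CommRing R] {n : ℕ} (F : ℕ → R) (h0 : F 0 = 0)
    (hn : F (n + 1) = 0) (x y : R) (i : Fin n) :
    ∑ l : Fin n, (if i = l then x
        else if ((i : ℕ) : ℤ) - ((l : ℕ) : ℤ) = 1 ∨ ((l : ℕ) : ℤ) - ((i : ℕ) : ℤ) = 1 then -y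
        else 0) * F (l + 1)
      = x * F (i + 1) - y * (F i + F (i + 2)) := by
  obtain ⟨i, hi⟩ := i
  have split_row (l : Fin n) : (if (⟨i, hi⟩ : Fin n) = l then x
        else if (i : ℤ) - ((l : ℕ) : ℤ) = 1 ∨ ((l : ℕ) : ℤ) - (i : ℤ) = 1 then -y
        else 0) * F (l + 1)
      = (if (l : ℕ) = i then x * F (l + 1) else 0) - (if (l : ℕ) + 1 = i then y * F (l + 1) else 0)
        - (if (l : ℕ) = i + 1 then y * F (l + 1) else 0) := by
    simp only [Fin.ext_iff]
    split_ifs <;> first | omega | ring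
  have lower : ∑ l ∈ range n, (if l + 1 = i then y * F (l + 1) else 0) = y * F i := by
    cases i with
    | zero => simp [h0]
    | succ k =>
      simp only [Nat.add_right_cancel_iff, Finset.sum_ite_eq', mem_range]
      rw [if_pos (by omega)]
  have upper : ∑ l ∈ range n, (if l = i + 1 then y * F (l + 1) else 0) = y * F (i + 2) := by
    rw [Finset.sum_ite_eq']
    split_ifs with h
    · rfl
    · obtain rfl : n = i + 1 := by rw [mem_range] at h; omega
      rw [hn, mul_zero]
  simp only [split_row]
  rw [Fin.sum_univ_eq_sum_range (fun l => (if l = i then x * F (l + 1) else 0)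
    - (if l + 1 = i then y * F (l + 1) else 0) - (if l = i + 1 then y * F (l + 1) else 0)),
    Finset.sum_sub_distrib, Finset.sum_sub_distrib, lower, upper, Finset.sum_ite_eq',
    if_pos (mem_range.mpr hi)]
  ring

/-- `B⁽ᵐ⁾·C⁽ᵐ⁾ = [m]_q²·I` where `B⁽ᵐ⁾_{ij} = [A_{ij}m]_q` (q-deformed symmetrized Cartan
matrix of `sl_N`) and `C⁽ᵐ⁾_{ij} = [(N − max(i,j))m]_q[min(i,j)m]_q/[Nm]_q`. -/
theorem cartan_qdeformed_inverse (N : ℕ) (hN : 2 ≤ N) (q : ℂ) (hq : q ≠ 0)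
    (hq2 : q ^ 2 ≠ 1) (m : ℤ) (hm : q ^ (2 * (N : ℤ) * m) ≠ 1)
    (A : Fin (N - 1) → Fin (N - 1) → ℤ)
    (hA : ∀ i j, A i j = if i = j then 2
      else if ((i : ℕ) : ℤ) - ((j : ℕ) : ℤ) = 1 ∨ ((j : ℕ) : ℤ) - ((i : ℕ) : ℤ) = 1 then -1
      else 0)
    (C : Fin (N - 1) → Fin (N - 1) → ℂ)
    (hC : ∀ i j, C i j =
      qint q (((N : ℤ) - (max ((i : ℕ) + 1) ((j : ℕ) + 1) : ℕ)) * m) *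
        qint q ((min ((i : ℕ) + 1) ((j : ℕ) + 1) : ℕ) * m) / qint q ((N : ℤ) * m)) :
    ∀ i j : Fin (N - 1),
      ∑ l : Fin (N - 1), qint q (A i l * m) * C l j
        = (qint q m) ^ 2 * (if i = j then 1 else 0) := by
  intro i j
  obtain ⟨n, rfl⟩ : ∃ n, N = n + 1 := ⟨N - 1, by omega⟩
  have hN0 : qint q (((n + 1 : ℕ) : ℤ) * m) ≠ 0 := qint_ne_zero hq hq2 (by rwa [← mul_assoc])
  set F : ℕ → ℂ := fun l =>
    qint q ((((n + 1 : ℕ) : ℤ) - (max l ((j : ℕ) + 1) : ℕ)) * m) *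
      qint q ((min l ((j : ℕ) + 1) : ℕ) * m) with hF
  have hj : (j : ℕ) < n := j.isLt
  have F_of_le {l : ℕ} (h : l ≤ j + 1) :
      F l = qint q ((n - j : ℤ) * m) * qint q (l * m) := by
    simp only [hF, max_eq_right h, min_eq_left h]
    congr 3
    push_cast
    ring
  have F_of_ge {l : ℕ} (h : (j : ℕ) + 1 ≤ l) :
      F l = qint q ((n + 1 - l : ℤ) * m) * qint q ((j + 1 : ℤ) * m) := by
    simp only [hF, max_eq_left h, min_eq_right h]
    push_cast
    rfl
  have hB (l : Fin n) : qint q (A i l * m) = if i = l then qint q (2 * m)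
      else if ((i : ℕ) : ℤ) - ((l : ℕ) : ℤ) = 1 ∨ ((l : ℕ) : ℤ) - ((i : ℕ) : ℤ) = 1
        then -qint q m else 0 := by
    rw [hA]
    split_ifs
    · rfl
    · rw [neg_one_mul, qint_neg]
    · rw [zero_mul, qint_zero]
  have hsum : ∑ l : Fin n, qint q (A i l * m) * C l j
      = (qint q (2 * m) * F (i + 1) - qint q m * (F i + F (i + 2)))
        / qint q (((n + 1 : ℕ) : ℤ) * m) := by
    rw [← sum_tridiagonal F (by rw [F_of_le (Nat.zero_le _)]; simp [qint_zero])
      (by rw [F_of_ge (by omega)]; simp [qint_zero]) _ _ (i : Fin n), Finset.sum_div]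
    refine Finset.sum_congr rfl fun l _ => ?_
    rw [hB, hC, ← mul_div_assoc]
  refine hsum.trans ?_
  rw [div_eq_iff hN0]
  rcases lt_trichotomy (i : ℕ) j with h | h | h
  · have key := qint_two_mul_mul q hq m (((i : ℕ) + 1 : ℤ) * m)
    rw [F_of_le (by omega), F_of_le (by omega), F_of_le (by omega),
      if_neg (by rintro rfl; omega)]
    push_cast
    ring_nf at key ⊢
    linear_combination qint q (m * n - m * (j : ℕ)) * key
  · obtain rfl : i = j := Fin.ext h
    have key := qint_two_mul_mul_mul q hq m ((n - (i : ℕ) : ℤ) * m) (((i : ℕ) + 1 : ℤ) * m)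
    rw [F_of_le (by omega), F_of_le (by omega), F_of_ge (by omega), if_pos rfl]
    push_cast
    ring_nf at key ⊢
    linear_combination key
  · have key := qint_two_mul_mul q hq m ((n - (i : ℕ) : ℤ) * m)
    rw [F_of_ge (by omega), F_of_ge (by omega), F_of_ge (by omega),
      if_neg (by rintro rfl; omega)]
    push_cast
    ring_nf at key ⊢
    linear_combination qint q (m + m * (j : ℕ)) * key
end

section
/- Let N ≥ 1 be an integer, q ∈ ℂ∖{0}, and let Λ_i : ℂ∖{0} → ℂ∖{0} (i = 1, …, N) and Q_i : ℂ∖{0} → ℂ∖{0} (i = 0, 1, …, N) be nowhere-vanishing functions with Q₀ ≡ 1 and Q_N ≡ 1, satisfying the first-order q-difference equations Q_i(zq²)·Q_{i−1}(zq^{−2}) = Λ_i(z)·Q_i(z)·Q_{i−1}(z) for all z ≠ 0 and all i = 1, …, N (equivalently, (D_q − Λ_i(z)) annihilates Q_i(z)/Q_{i−1}(zq^{−2}), where (D_q g)(z) = g(zq²)). Define σ₀ ≡ 1 and, for 1 ≤ i ≤ N, σ_i(z) = Σ_{1≤j₁<j₂<⋯<j_i≤N} Λ_{j₁}(z)·Λ_{j₂}(zq²)·⋯·Λ_{j_i}(zq^{2(i−1)}).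 Then σ_N(z) = 1 for all z ≠ 0, and Σ_{p=0}^{N} (−1)^{N−p}·σ_p(z)·Q_{N−1}(zq^{2(p−1)}) = 0 for all z ≠ 0; that is, the function z ↦ Q_{N−1}(zq^{−2}) is annihilated by the N-th order q-difference operator D_q^N − σ_{N−1}(z)·D_q^{N−1} + σ_{N−2}(z)·D_q^{N−2} − ⋯ + (−1)^{N−1}·σ₁(z)·D_q + (−1)^N. -/
open Finset

/-- The sum over strictly increasing `jf : Fin p → Fin n` of `∏ r, a (jf r) r`. -/
noncomputable def strictMonoSum (a : ℕ → ℕ → ℂ) (p n : ℕ) : ℂ :=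
  ∑ jf ∈ Finset.univ.filter
      (fun jf : Fin p → Fin n => ∀ r s : Fin p, r < s → jf r < jf s),
    ∏ r : Fin p, a (jf r) r

lemma strictMonoSum_zero (a : ℕ → ℕ → ℂ) (n : ℕ) : strictMonoSum a 0 n = 1 := by
  simp [strictMonoSum]

lemma strictMonoSum_of_lt (a : ℕ → ℕ → ℂ) {p n : ℕ} (h : n < p) :
    strictMonoSum a p n = 0 := by
  rw [strictMonoSum, Finset.sum_eq_zero]
  intro jf hjf
  have hmono : StrictMono jf := fun r s hrs => (Finset.mem_filter.1 hjf).2 r s hrs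
  have := Fintype.card_le_of_injective jf hmono.injective
  simp only [Fintype.card_fin] at this
  omega

lemma strictMonoSum_succ_succ (a : ℕ → ℕ → ℂ) (p n : ℕ) :
    strictMonoSum a (p + 1) (n + 1) =
      strictMonoSum a (p + 1) n + strictMonoSum a p n * a n p := by
  unfold strictMonoSum
  rw [← Finset.sum_filter_not_add_sum_filter _ (fun jf => jf (Fin.last p) = Fin.last n),
    Finset.sum_mul]
  congr 1
  · symm
    refine Finset.sum_nbij (fun f r => (f r).castSucc) ?_ ?_ ?_ ?_
    · intro f hf
      simp only [Finset.mem_filter, Finset.mem_univ, true_and] at hf ⊢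
      exact ⟨fun r s hrs => Fin.castSucc_lt_castSucc_iff.2 (hf r s hrs),
        Fin.castSucc_ne_last _⟩
    · intro f _ g _ hfg
      funext r
      exact Fin.castSucc_injective _ (congrFun hfg r)
    · intro g hg
      simp only [Finset.coe_filter, Finset.mem_filter, Finset.mem_univ, true_and,
        Set.mem_ofPred_eq] at hg
      obtain ⟨hmono, hlast⟩ := hg
      have hlt : ∀ r, (g r : ℕ) < n := by
        intro r
        have h1 : (g (Fin.last p) : ℕ) < n := Fin.val_lt_last hlast
        rcases (Fin.le_last r).lt_or_eq with h | h
        · have h2 : (g r : ℕ) < g (Fin.last p) := hmono _ _ h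
          omega
        · rwa [h]
      refine ⟨fun r => (g r).castLT (hlt r), ?_, ?_⟩
      · simp only [Finset.coe_filter, Finset.mem_univ, true_and, Set.mem_ofPred_eq]
        exact fun r s hrs => hmono r s hrs
      · funext r
        simp
    · intro f _
      simp
  · symm
    refine Finset.sum_nbij
      (fun f => Fin.snoc (α := fun _ => Fin (n + 1)) (fun r => (f r).castSucc) (Fin.last n))
      ?_ ?_ ?_ ?_
    · intro f hf
      simp only [Finset.mem_filter, Finset.mem_univ, true_and, Fin.snoc_last, and_true] at hf ⊢
      intro r s
      refine Fin.lastCases ?_ (fun s => ?_) s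
      · refine Fin.lastCases ?_ (fun r => ?_) r
        · simp
        · simp [Fin.castSucc_lt_last]
      · refine Fin.lastCases ?_ (fun r => ?_) r
        · intro h
          exact absurd h (Fin.castSucc_lt_last s).not_gt
        · simpa using hf r s
    · intro f _ g _ hfg
      funext r
      have := congrFun hfg r.castSucc
      simpa using this
    · intro g hg
      simp only [Finset.coe_filter, Finset.mem_filter, Finset.mem_univ, true_and,
        Set.mem_ofPred_eq] at hg
      obtain ⟨hmono, hlast⟩ := hg
      have hlt : ∀ r : Fin p, (g r.castSucc : ℕ) < n := by
        intro r
        have h2 : g r.castSucc < g (Fin.last p) := hmono _ _ (Fin.castSucc_lt_last r)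
        rw [hlast] at h2
        exact h2
      refine ⟨fun r => (g r.castSucc).castLT (hlt r), ?_, ?_⟩
      · simp only [Finset.coe_filter, Finset.mem_univ, true_and, Set.mem_ofPred_eq]
        exact fun r s hrs => hmono _ _ (Fin.castSucc_lt_castSucc_iff.2 hrs)
      · funext r
        refine Fin.lastCases ?_ (fun r => ?_) r
        · simp [hlast]
        · simp
    · intro f _
      simp [Fin.prod_univ_castSucc]

lemma strictMonoSum_self (a : ℕ → ℕ → ℂ) (n : ℕ) :
    strictMonoSum a n n = ∏ i ∈ Finset.range n, a i i := by
  induction n with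
  | zero => simp [strictMonoSum_zero]
  | succ n ih =>
    rw [strictMonoSum_succ_succ, strictMonoSum_of_lt a n.lt_succ_self, zero_add, ih,
      Finset.prod_range_succ]

/-- If the last row of `a` shifts `g` back by one step, the alternating sum of the
`strictMonoSum`s against `g` telescopes to zero. -/
lemma sum_strictMonoSum_mul_eq_zero (a : ℕ → ℕ → ℂ) (n : ℕ) (g : ℕ → ℂ)
    (h : ∀ p, a n p * g (p + 1) = g p) :
    ∑ p ∈ Finset.range (n + 2),
      (-1 : ℂ) ^ (n + 1 - p) * strictMonoSum a p (n + 1) * g p = 0 := by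
  have key : ∀ m ≤ n + 1, ∑ p ∈ Finset.range (m + 1),
      (-1 : ℂ) ^ (n + 1 - p) * strictMonoSum a p (n + 1) * g p =
        (-1 : ℂ) ^ (n + 1 - m) * (strictMonoSum a m n * g m) := by
    intro m
    induction m with
    | zero => simp [strictMonoSum_zero]
    | succ m ih =>
      intro hm
      rw [Finset.sum_range_succ, ih (by omega), strictMonoSum_succ_succ,
        show n + 1 - m = (n + 1 - (m + 1)) + 1 by omega, pow_succ, ← h m]
      ring
  rw [key (n + 1) le_rfl, strictMonoSum_of_lt a n.lt_succ_self]
  simp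

/-- Elements of the spectrum of the q-deformed W-algebra `W_h(sl_N)` as N-th order
q-difference operators: if `Q_i(zq²)Q_{i−1}(zq⁻²) = Λ_i(z)Q_i(z)Q_{i−1}(z)` (with
`Q₀ = Q_N = 1`) and `σ_i(z) = Σ_{j₁<⋯<j_i} Λ_{j₁}(z)Λ_{j₂}(zq²)⋯Λ_{j_i}(zq^{2(i−1)})`,
then `σ_N = 1` and `Σ_{p=0}^{N} (−1)^{N−p} σ_p(z) Q_{N−1}(zq^{2(p−1)}) = 0`, i.e.
`z ↦ Q_{N−1}(zq⁻²)` is annihilated by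
`D_q^N − σ_{N−1}D_q^{N−1} + σ_{N−2}D_q^{N−2} − ⋯ + (−1)^{N−1}σ₁D_q + (−1)^N`. -/
theorem qdifference_operator_factorization (N : ℕ) (hN : 1 ≤ N) (q : ℂ) (hq : q ≠ 0)
    (Λ : ℕ → ℂ → ℂ) (hΛ : ∀ i ∈ Finset.Icc 1 N, ∀ z : ℂ, z ≠ 0 → Λ i z ≠ 0)
    (Q : ℕ → ℂ → ℂ)
    (hQ0 : ∀ z, Q 0 z = 1) (hQN : ∀ z, Q N z = 1)
    (hQne : ∀ i ≤ N, ∀ z : ℂ, z ≠ 0 → Q i z ≠ 0)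
    (hdiff : ∀ i ∈ Finset.Icc 1 N, ∀ z : ℂ, z ≠ 0 →
      Q i (z * q ^ 2) * Q (i - 1) (z * q ^ (-2 : ℤ)) = Λ i z * Q i z * Q (i - 1) z)
    (σ : ℕ → ℂ → ℂ)
    (hσ0 : ∀ z, σ 0 z = 1)
    (hσ : ∀ i : ℕ, 1 ≤ i → i ≤ N → ∀ z : ℂ,
      σ i z = ∑ jf ∈ Finset.univ.filter
          (fun jf : Fin i → Fin N => ∀ r s : Fin i, r < s → jf r < jf s),
        ∏ r : Fin i, Λ ((jf r : ℕ) + 1) (z * q ^ (2 * (r : ℕ)))) :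
    (∀ z : ℂ, z ≠ 0 → σ N z = 1) ∧
    (∀ z : ℂ, z ≠ 0 →
      ∑ p ∈ Finset.range (N + 1),
        (-1 : ℂ) ^ (N - p) * σ p z * Q (N - 1) (z * q ^ (2 * (p : ℤ) - 2)) = 0) := by
  have hσ' : ∀ p ≤ N, ∀ z, σ p z =
      strictMonoSum (fun j r => Λ (j + 1) (z * q ^ (2 * r))) p N := by
    intro p hp z
    rcases Nat.eq_zero_or_pos p with rfl | hpos
    · rw [hσ0, strictMonoSum_zero]
    · exact hσ p hpos hp z
  refine ⟨fun z hz => ?_, fun z hz => ?_⟩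
  · have key : ∀ m ≤ N, (∏ i ∈ Finset.range m, Λ (i + 1) (z * q ^ (2 * i))) *
        Q m (z * q ^ (2 * (m : ℤ) - 2)) = Q m (z * q ^ (2 * m)) := by
      intro m
      induction m with
      | zero => simp [hQ0]
      | succ m ih =>
        intro hm
        have hw : z * q ^ (2 * m) ≠ 0 := mul_ne_zero hz (pow_ne_zero _ hq)
        have hd := hdiff (m + 1) (Finset.mem_Icc.2 ⟨by omega, hm⟩) _ hw
        have e1 : z * q ^ (2 * m) * q ^ 2 = z * q ^ (2 * (m + 1)) := by ring
        have e2 : z * q ^ (2 * m) * q ^ (-2 : ℤ) = z * q ^ (2 * (m : ℤ) - 2) := by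
          rw [mul_assoc, ← zpow_natCast, ← zpow_add₀ hq]
          push_cast
          rfl
        have e3 : z * q ^ (2 * ((m + 1 : ℕ) : ℤ) - 2) = z * q ^ (2 * m) := by
          rw [← zpow_natCast q (2 * m)]
          congr 2
          push_cast
          ring
        rw [e1, e2, Nat.add_sub_cancel] at hd
        rw [e3, Finset.prod_range_succ]
        have hi := ih (by omega)
        have hB := hQne m (by omega) (z * q ^ (2 * (m : ℤ) - 2))
          (mul_ne_zero hz (zpow_ne_zero _ hq))
        apply mul_right_cancel₀ hB
        rw [hd, ← hi]
        ring
    have h := key N le_rfl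
    rw [hσ' N le_rfl, strictMonoSum_self]
    simpa only [hQN, mul_one] using h
  · obtain ⟨n, rfl⟩ : ∃ n, N = n + 1 := ⟨N - 1, by omega⟩
    rw [← sum_strictMonoSum_mul_eq_zero (fun j r => Λ (j + 1) (z * q ^ (2 * r))) n
      (fun p => Q n (z * q ^ (2 * (p : ℤ) - 2))) ?_]
    · refine Finset.sum_congr rfl fun p hp => ?_
      rw [hσ' p (by have := Finset.mem_range.1 hp; omega), Nat.add_sub_cancel]
    · intro p
      have hd := hdiff (n + 1) (Finset.mem_Icc.2 ⟨by omega, le_rfl⟩) (z * q ^ (2 * p))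
        (mul_ne_zero hz (pow_ne_zero _ hq))
      rw [hQN, hQN, one_mul, mul_one, Nat.add_sub_cancel, mul_assoc z, ← zpow_natCast,
        ← zpow_add₀ hq] at hd
      have e : 2 * ((p + 1 : ℕ) : ℤ) - 2 = ((2 * p : ℕ) : ℤ) := by
        push_cast
        ring
      have e' : 2 * (p : ℤ) - 2 = ((2 * p : ℕ) : ℤ) + -2 := by
        push_cast
        ring
      simp only [e, e']
      rw [hd, zpow_natCast]
end
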